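/- Let p be a prime, K = ℂ_p, π ∈ K with π^{p-1} = −p, and A an n×n nonnegative integer matrix with 0 < det A < p whose reduction is Berglund–Hübsch over the residue field of K. Then the Frobenius endomorphism Fr_A = ((Θ''_A ∘ Θ'_A) ⊗ Id_{⋀(K^n)}) ∘ p^{Q_A + Q^∨_A} is a chain map B^†_A(K) → B^†_A(K), and as linear maps S^†_A(K) ⊗ ⋀(K^n) → S^†_{A^T}(K) ⊗ ⋀(K^n) one has Δ^A ∘ Fr_A = Fr_{A^T} ∘ Δ^A ∘ p^{2·ext − n} ∘ p^{−2Q̂_A} ∘ p^{2Q^∨_A}. -/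

import Mathlib

open scoped BigOperators TensorProduct
open Matrix Classical

noncomputable section

/-- The invertible-type polynomial `W_A = ∑ i, ∏ j, x_j ^ A i j`. -/
def Wpoly (F : Type) [Field F] {ι : Type} [Fintype ι] (A : Matrix ι ι ℕ) :
    MvPolynomial ι F :=
  ∑ i, ∏ j, MvPolynomial.X j ^ A i j

/-- `A` is a Berglund–Hübsch matrix over the field `F`. -/
def IsBH (F : Type) [Field F] {ι : Type} [Fintype ι] [LinearOrder ι]
    (A : Matrix ι ι ℕ) : Prop :=
  (A.map ((↑) : ℕ → ℚ)).det ≠ 0 ∧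
  (ringChar F = 0 ∨ ((A.map ((↑) : ℕ → ℤ)).det < (ringChar F : ℤ))) ∧
  (∃ q : ι → ℚ, (∀ j, 0 < q j) ∧ ∀ i, (∑ j, (A i j : ℚ) * q j) = 1) ∧
  RingTheory.Sequence.IsRegular (MvPolynomial ι F)
    ((Finset.univ.sort (· ≤ ·)).map fun i => MvPolynomial.pderiv i (Wpoly F A))

/-- The model for the exterior algebra `⋀(Fⁿ)`: the free `F`-module on the standard
basis monomials `e_S = e_{s_1} ∧ … ∧ e_{s_k}`, `s_1 < … < s_k`, indexed by finite sets. -/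
abbrev ExtV (F : Type) (ι : Type) := Finset ι → F

/-- Exterior multiplication by `e_i` on `⋀(Fⁿ)`. -/
def mulE (F : Type) [Field F] {ι : Type} [LinearOrder ι] (i : ι) :
    ExtV F ι →ₗ[F] ExtV F ι where
  toFun f S := if i ∈ S then (-1 : F) ^ (S.filter (· < i)).card * f (S.erase i) else 0
  map_add' f g := by
    funext S
    by_cases h : i ∈ S <;> simp [h, mul_add]
  map_smul' a f := by
    funext S
    by_cases h : i ∈ S <;> simp [h, mul_left_comm]

/-- Contraction `e_i^∨` on `⋀(Fⁿ)`. -/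
def contrE (F : Type) [Field F] {ι : Type} [LinearOrder ι] (i : ι) :
    ExtV F ι →ₗ[F] ExtV F ι where
  toFun f S := if i ∈ S then 0 else (-1 : F) ^ (S.filter (· < i)).card * f (insert i S)
  map_add' f g := by
    funext S
    by_cases h : i ∈ S <;> simp [h, mul_add]
  map_smul' a f := by
    funext S
    by_cases h : i ∈ S <;> simp [h, mul_left_comm]

/-- `E_{A,i} = π ∑_j A_{ij} e_j`. -/
def EA (F : Type) [Field F] {ι : Type} [Fintype ι] [LinearOrder ι]
    (π : F) (A : Matrix ι ι ℕ) (i : ι) : ExtV F ι →ₗ[F] ExtV F ι :=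
  π • ∑ j, (A i j : F) • mulE F j

/-- `E^∨_{A,i} = π⁻¹ ∑_j (A⁻¹)_{ji} e_j^∨`, the inverse matrix being computed over `F`. -/
def EAdual (F : Type) [Field F] {ι : Type} [Fintype ι] [LinearOrder ι]
    (π : F) (A : Matrix ι ι ℕ) (i : ι) : ExtV F ι →ₗ[F] ExtV F ι :=
  π⁻¹ • ∑ j, ((A.map ((↑) : ℕ → F))⁻¹ j i) • contrE F j

/-- The element `E_{Aᵀ,1} E_{Aᵀ,2} ⋯ E_{Aᵀ,n} (1) ∈ ⋀(Fⁿ)`. -/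
def starTop (F : Type) [Field F] {ι : Type} [Fintype ι] [LinearOrder ι]
    (π : F) (A : Matrix ι ι ℕ) : ExtV F ι :=
  (Finset.univ.sort (· ≤ ·)).foldr (fun i v => EA F π Aᵀ i v)
    (Pi.single (∅ : Finset ι) (1 : F))

/-- Borisov's duality operator `*^A`, defined on the standard basis by
`*^A(e_{i_1} ∧ … ∧ e_{i_k}) = E^∨_{Aᵀ,i_1} ⋯ E^∨_{Aᵀ,i_k}(E_{Aᵀ,1} ⋯ E_{Aᵀ,n}(1))`. -/
def starA (F : Type) [Field F] {ι : Type} [Fintype ι] [LinearOrder ι]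
    (π : F) (A : Matrix ι ι ℕ) : ExtV F ι →ₗ[F] ExtV F ι :=
  (Pi.basisFun F (Finset ι)).constr F fun S =>
    (S.sort (· ≤ ·)).foldr (fun i v => EAdual F π Aᵀ i v) (starTop F π A)

/-- Index of a monomial `x^γ y^λ`. -/
abbrev MonIdx (ι : Type) := (ι → ℕ) × (ι → ℕ)

/-- The matrix `A` viewed over `ℚ`. -/
def Aq {ι : Type} [Fintype ι] [LinearOrder ι] (A : Matrix ι ι ℕ) : Matrix ι ι ℚ :=
  A.map ((↑) : ℕ → ℚ)

/-- The row vector `λ A⁻ᵀ`, computed over `ℚ`. -/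
def lamRow {ι : Type} [Fintype ι] [LinearOrder ι] (A : Matrix ι ι ℕ) (lam : ι → ℕ) :
    ι → ℚ :=
  Matrix.vecMul (fun i => (lam i : ℚ)) ((Aq A)ᵀ)⁻¹

/-- The row vector `γ A⁻¹`, computed over `ℚ`. -/
def gamRow {ι : Type} [Fintype ι] [LinearOrder ι] (A : Matrix ι ι ℕ) (gam : ι → ℕ) :
    ι → ℚ :=
  Matrix.vecMul (fun i => (gam i : ℚ)) (Aq A)⁻¹

/-- The allowed monomials `x^γ y^λ` of `R_A`: `(λA⁻ᵀ)_i ≥ 0` for all `i`, and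
`γ A⁻¹ λᵀ = 0`. -/
def OKA {ι : Type} [Fintype ι] [LinearOrder ι] (A : Matrix ι ι ℕ) (m : MonIdx ι) : Prop :=
  (∀ i, 0 ≤ lamRow A m.2 i) ∧ (gamRow A m.1 ⬝ᵥ fun i => ((m.2 i : ℚ))) = 0


/-- The allowed monomial indices of `R_A`. -/
abbrev AMon {n : ℕ} (A : Matrix (Fin n) (Fin n) ℕ) : Type := {m : MonIdx (Fin n) // OKA A m}

/-- Index set for coefficients of elements of `R_A ⊗ ⋀(Kⁿ)`. -/
abbrev BIdx {n : ℕ} (A : Matrix (Fin n) (Fin n) ℕ) : Type := AMon A × Finset (Fin n)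

/-- The full coefficient space of (possibly infinite) series supported on the allowed
monomials of `R_A`. -/
abbrev RFull (K : Type) {n : ℕ} (A : Matrix (Fin n) (Fin n) ℕ) : Type := AMon A → K

/-- The full coefficient space of (possibly infinite) series in `R_A ⊗ ⋀(Kⁿ)`. -/
abbrev BFull (K : Type) {n : ℕ} (A : Matrix (Fin n) (Fin n) ℕ) : Type := BIdx A → K

/-- Diagonal operator with weight `w`. -/
def diagOp {K : Type} [Field K] {α : Type} (w : α → K) : (α → K) →ₗ[K] (α → K) where
  toFun c a := w a * c a
  map_add' c c' := by funext a; simp [mul_add]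
  map_smul' r c := by funext a; simp [mul_left_comm]

/-- The "transpose" of a partially defined index map: `(pullOp σ c) b = c (σ b)`,
with the convention that missing values contribute `0`. -/
def pullOp {K : Type} [Field K] {α β : Type} (σ : β → Option α) :
    (α → K) →ₗ[K] (β → K) where
  toFun c b := ((σ b).map c).getD 0
  map_add' c c' := by funext b; cases h : σ b <;> simp [h]
  map_smul' r c := by funext b; cases h : σ b <;> simp [h]

/-- The tensor product `T ⊗ L` of a coefficientwise operator `T` on series and an
operator `L` on the (finite-dimensional) exterior algebra. -/
def tmap {K : Type} [Field K] {n : ℕ} {α β : Type}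
    (T : (α → K) →ₗ[K] (β → K)) (L : ExtV K (Fin n) →ₗ[K] ExtV K (Fin n)) :
    (α × Finset (Fin n) → K) →ₗ[K] (β × Finset (Fin n) → K) where
  toFun c q := ∑ S : Finset (Fin n), L (Pi.single S 1) q.2 * T (fun m => c (m, S)) q.1
  map_add' c c' := by
    funext q
    have h : ∀ S : Finset (Fin n), T (fun m => c (m, S) + c' (m, S))
        = T (fun m => c (m, S)) + T (fun m => c' (m, S)) := fun S =>
      map_add T (fun m => c (m, S)) (fun m => c' (m, S))
    simp only [Pi.add_apply]
    simp only [h, Pi.add_apply, mul_add, Finset.sum_add_distrib]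
  map_smul' r c := by
    funext q
    have h : ∀ S : Finset (Fin n), T (fun m => r * c (m, S))
        = r • T (fun m => c (m, S)) := fun S =>
      _root_.map_smul T r (fun m => c (m, S))
    simp only [Pi.smul_apply, smul_eq_mul, RingHom.id_apply]
    simp only [h, Pi.smul_apply, smul_eq_mul, Finset.mul_sum, mul_left_comm]

/-- `φ_{A,i} = π ∑_j A_{ji} x^{e_j A}·`, acting on coefficients of series. -/
def phiF (K : Type) [Field K] {n : ℕ} (π : K) (A : Matrix (Fin n) (Fin n) ℕ) (i : Fin n) :
    RFull K A →ₗ[K] RFull K A :=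
  π • ∑ j, (A j i : K) • pullOp (fun m' : AMon A =>
    if h : (∀ k, A j k ≤ m'.1.1 k) ∧ OKA A ((fun k => m'.1.1 k - A j k), m'.1.2)
    then some ⟨((fun k => m'.1.1 k - A j k), m'.1.2), h.2⟩ else none)

/-- `ψ^∨_{A,i} = y^{e_i Aᵀ}·`, acting on coefficients of series. -/
def psidualF (K : Type) [Field K] {n : ℕ} (A : Matrix (Fin n) (Fin n) ℕ) (i : Fin n) :
    RFull K A →ₗ[K] RFull K A :=
  pullOp (fun m' : AMon A =>
    if h : (∀ j, A j i ≤ m'.1.2 j) ∧ OKA A (m'.1.1, fun j => m'.1.2 j - A j i)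
    then some ⟨(m'.1.1, fun j => m'.1.2 j - A j i), h.2⟩ else none)

/-- `θ_{A,i} + φ_{A,i}`. -/
def dxF (K : Type) [Field K] {n : ℕ} (π : K) (A : Matrix (Fin n) (Fin n) ℕ) (i : Fin n) :
    RFull K A →ₗ[K] RFull K A :=
  diagOp (fun m => (m.1.1 i : K)) + phiF K π A i

/-- `T^∨_{A,i} + ψ^∨_{A,i}`. -/
def dyF (K : Type) [Field K] {n : ℕ} (π : K) (A : Matrix (Fin n) (Fin n) ℕ) (i : Fin n) :
    RFull K A →ₗ[K] RFull K A :=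
  diagOp (fun m => π⁻¹ * ((lamRow A m.1.2 i : ℚ) : K)) + psidualF K A i

/-- The differential `d_A + d^∨_A` on series. -/
def dFull (K : Type) [Field K] {n : ℕ} (π : K) (A : Matrix (Fin n) (Fin n) ℕ) :
    BFull K A →ₗ[K] BFull K A :=
  (∑ i, tmap (dxF K π A i) (mulE K i)) + ∑ i, tmap (dyF K π A i) (contrE K i)

/-- The total degree `|γ| + |λ|` of a monomial. -/
def degMon {n : ℕ} (m : MonIdx (Fin n)) : ℕ := (∑ i, m.1 i) + ∑ i, m.2 i

/-- Overconvergence (à la Dwork–Monsky) of a series: there is `M > 0` with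
`ord_p(coefficient) ≥ M(|γ|+|λ|)`, i.e. `‖coefficient‖ ≤ p^{-M(|γ|+|λ|)}`, for all but
finitely many monomials. -/
def OvercR {K : Type} [NontriviallyNormedField K] {n : ℕ} {A : Matrix (Fin n) (Fin n) ℕ}
    (p : ℕ) (c : RFull K A) : Prop :=
  ∃ M : ℝ, 0 < M ∧
    {m : AMon A | ¬ ‖c m‖ ≤ (p : ℝ) ^ (-(M * (degMon m.1 : ℝ)))}.Finite

/-- Overconvergence of an element of `B^†_A(K)`. -/
def OvercB {K : Type} [NontriviallyNormedField K] {n : ℕ} {A : Matrix (Fin n) (Fin n) ℕ}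
    (p : ℕ) (c : BFull K A) : Prop :=
  ∃ M : ℝ, 0 < M ∧
    {q : BIdx A | ¬ ‖c q‖ ≤ (p : ℝ) ^ (-(M * (degMon q.1.1 : ℝ)))}.Finite

/-- Polynomial (finitely supported) elements of `B_A(K)`. -/
def FinSuppB {K : Type} [Field K] {n : ℕ} {A : Matrix (Fin n) (Fin n) ℕ}
    (c : BFull K A) : Prop :=
  (Function.support c).Finite

/-- The condition `(γA⁻¹)_i ≥ 0` for all `i` cutting out `S_A ⊆ R_A`. -/
def gamOK {n : ℕ} (A : Matrix (Fin n) (Fin n) ℕ) (q : BIdx A) : Prop :=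
  ∀ i, 0 ≤ gamRow A q.1.1.1 i

/-- Membership in the subcomplex `C_A(K) = S_A(K) ⊗ ⋀(Kⁿ)` (polynomial version). -/
def CFin {K : Type} [Field K] {n : ℕ} {A : Matrix (Fin n) (Fin n) ℕ}
    (c : BFull K A) : Prop :=
  FinSuppB c ∧ ∀ q, c q ≠ 0 → gamOK A q

/-- Membership in the subcomplex `C^†_A(K) = S^†_A(K) ⊗ ⋀(Kⁿ)` (overconvergent
version). -/
def COver {K : Type} [NontriviallyNormedField K] {n : ℕ} {A : Matrix (Fin n) (Fin n) ℕ}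
    (p : ℕ) (c : BFull K A) : Prop :=
  OvercB p c ∧ ∀ q, c q ≠ 0 → gamOK A q

/-- The eigenvalue of `Q^∨_A = ∑ i, Q^∨_{A,i}` on the basis monomial indexed by `q`:
the number of `i ∉ S` with `(λA⁻ᵀ)_i ≠ 0`. -/
def qexpDual {n : ℕ} (A : Matrix (Fin n) (Fin n) ℕ) (q : BIdx A) : ℕ :=
  (Finset.univ.filter fun i => i ∉ q.2 ∧ lamRow A q.1.1.2 i ≠ 0).card

/-- The eigenvalue of `Q_A = ∑ i, Q_{A,i}` on the basis monomial indexed by `q`. -/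
def qexpQ {n : ℕ} (A : Matrix (Fin n) (Fin n) ℕ) (q : BIdx A) : ℕ :=
  q.2.card + qexpDual A q

/-- The diagonal operator `p^{Q_A}`. -/
def pQdiag (K : Type) [Field K] {n : ℕ} (p : ℕ) (A : Matrix (Fin n) (Fin n) ℕ) :
    BFull K A →ₗ[K] BFull K A :=
  diagOp fun q => (p : K) ^ (qexpQ A q)

/-- The diagonal operator `p^{Q^∨_A}`. -/
def pQdualdiag (K : Type) [Field K] {n : ℕ} (p : ℕ) (A : Matrix (Fin n) (Fin n) ℕ) :
    BFull K A →ₗ[K] BFull K A :=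
  diagOp fun q => (p : K) ^ (qexpDual A q)

/-- The diagonal operator `p^{Q_A + Q^∨_A}`. -/
def pQQdualdiag (K : Type) [Field K] {n : ℕ} (p : ℕ) (A : Matrix (Fin n) (Fin n) ℕ) :
    BFull K A →ₗ[K] BFull K A :=
  diagOp fun q => (p : K) ^ (qexpQ A q + qexpDual A q)

/-- The diagonal operator `p^{2·Q^∨_A}`. -/
def pQdual2diag (K : Type) [Field K] {n : ℕ} (p : ℕ) (A : Matrix (Fin n) (Fin n) ℕ) :
    BFull K A →ₗ[K] BFull K A :=
  diagOp fun q => (p : K) ^ (2 * qexpDual A q)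

/-- The diagonal operator `p^{2·ext − n}` (where `ext` is the exterior degree). -/
def pExtDiag (K : Type) [Field K] {n : ℕ} (p : ℕ) (A : Matrix (Fin n) (Fin n) ℕ) :
    BFull K A →ₗ[K] BFull K A :=
  diagOp fun q => (p : K) ^ (2 * (q.2.card : ℤ) - (n : ℤ))

/-- `Θ'_A : x^γ y^λ ↦ x^{pγ} y^{pλ}`, acting on coefficients of series. -/
def ThetaPrimeF (K : Type) [Field K] {n : ℕ} (p : ℕ) (A : Matrix (Fin n) (Fin n) ℕ) :
    RFull K A →ₗ[K] RFull K (p • A) :=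
  pullOp fun m' : AMon (p • A) =>
    if h : OKA A ((fun i => m'.1.1 i / p), (fun i => m'.1.2 i / p)) ∧
        (∀ i, p ∣ m'.1.1 i ∧ p ∣ m'.1.2 i)
    then some ⟨((fun i => m'.1.1 i / p), (fun i => m'.1.2 i / p)), h.1⟩ else none

/-- `Fr'_A = (Θ'_A ⊗ Id) ∘ p^{Q_A} : B^†_A(K) → B^†_{pA}(K)`. -/
def FrPrime (K : Type) [Field K] {n : ℕ} (p : ℕ)
    (A : Matrix (Fin n) (Fin n) ℕ) : BFull K A →ₗ[K] BFull K (p • A) :=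
  (tmap (ThetaPrimeF K p A) LinearMap.id).comp (pQdiag K p A)

/-- The coefficients of the Dwork exponential `exp(π(t^p − t)) = ∑ d_m t^m`:
`d_m = ∑_{a + pb = m} (−1)^a π^{a+b}/(a! b!)`. -/
def dworkCoef (K : Type) [Field K] (p : ℕ) (π : K) (m : ℕ) : K :=
  ∑ ab ∈ Finset.range (m + 1) ×ˢ Finset.range (m + 1),
    if ab.1 + p * ab.2 = m then
      ((-1 : K) ^ ab.1 * π ^ (ab.1 + ab.2)) / ((ab.1.factorial : K) * (ab.2.factorial : K))
    else 0

/-- The coefficient of `x^δ` in `Z_A(x) = exp(π(W_{pA}(x) − W_A(x)))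
= ∏_i exp(π((x^{e_iA})^p − x^{e_iA}))`. -/
def Zcoef (K : Type) [Field K] {n : ℕ} (p : ℕ) (π : K) (A : Matrix (Fin n) (Fin n) ℕ)
    (δ : Fin n → ℕ) : K :=
  ∑ k ∈ Fintype.piFinset (fun _ : Fin n => Finset.range ((∑ j, δ j) + 1)),
    if ∀ j, (∑ i, k i * A i j) = δ j then ∏ i, dworkCoef K p π (k i) else 0

/-- `Θ''_A`: multiplication by `Z_A(x) Z_{Aᵀ}(y)`, as a map `R^†_{pA}(K) → R^†_A(K)`
(computed on coefficients; monomials violating the support conditions are set to `0`). -/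
def ZmulF (K : Type) [Field K] {n : ℕ} (p : ℕ) (π : K) (A : Matrix (Fin n) (Fin n) ℕ) :
    RFull K (p • A) →ₗ[K] RFull K A where
  toFun c m' :=
    ∑ δ ∈ Fintype.piFinset (fun _ : Fin n => Finset.range ((∑ j, m'.1.1 j) + 1)),
      ∑ ε ∈ Fintype.piFinset (fun _ : Fin n => Finset.range ((∑ j, m'.1.2 j) + 1)),
        Zcoef K p π A δ * Zcoef K p π Aᵀ ε *
          (if h : (∀ k, δ k ≤ m'.1.1 k) ∧ (∀ k, ε k ≤ m'.1.2 k) ∧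
              OKA (p • A) ((fun k => m'.1.1 k - δ k), (fun k => m'.1.2 k - ε k))
          then c ⟨((fun k => m'.1.1 k - δ k), (fun k => m'.1.2 k - ε k)), h.2.2⟩ else 0)
  map_add' c c' := by
    funext m'
    have key : ∀ (P : Prop) (hP : Decidable P) (f g : P → K),
        (dite P (fun h => f h + g h) (fun _ => (0 : K)))
          = dite P f (fun _ => 0) + dite P g (fun _ => 0) := by
      intro P hP f g; split <;> simp
    simp only [Pi.add_apply, key, mul_add, Finset.sum_add_distrib]
  map_smul' r c := by
    funext m'
    have key : ∀ (P : Prop) (hP : Decidable P) (f : P → K),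
        (dite P (fun h => r * f h) (fun _ => (0 : K))) = r * dite P f (fun _ => 0) := by
      intro P hP f; split <;> simp
    simp only [Pi.smul_apply, smul_eq_mul, RingHom.id_apply, key, Finset.mul_sum,
      mul_left_comm]

/-- `Fr''_A = (Θ''_A ⊗ Id) ∘ p^{Q^∨_{pA}} : B^†_{pA}(K) → B^†_A(K)`. -/
def FrDoublePrime (K : Type) [Field K] {n : ℕ} (p : ℕ) (π : K)
    (A : Matrix (Fin n) (Fin n) ℕ) : BFull K (p • A) →ₗ[K] BFull K A :=
  (tmap (ZmulF K p π A) LinearMap.id).comp (pQdualdiag K p (p • A))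

/-- The Frobenius endomorphism `Fr_A = ((Θ''_A ∘ Θ'_A) ⊗ Id) ∘ p^{Q_A + Q^∨_A}`. -/
def FrFull (K : Type) [Field K] {n : ℕ} (p : ℕ) (π : K)
    (A : Matrix (Fin n) (Fin n) ℕ) : BFull K A →ₗ[K] BFull K A :=
  (tmap ((ZmulF K p π A).comp (ThetaPrimeF K p A)) LinearMap.id).comp (pQQdualdiag K p A)

/-- The transposition map `D^A : x^γ y^λ ↦ x^λ y^γ` on coefficients of series. -/
def DAmapF (K : Type) [Field K] {n : ℕ} (A : Matrix (Fin n) (Fin n) ℕ) :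
    RFull K A →ₗ[K] RFull K Aᵀ :=
  pullOp fun m' : AMon Aᵀ =>
    if h : OKA A (m'.1.2, m'.1.1) then some ⟨(m'.1.2, m'.1.1), h⟩ else none

/-- Berglund–Hübsch duality `Δ^A = D^A ⊗ *^A` on series. -/
def DeltaF (K : Type) [Field K] {n : ℕ} (π : K) (A : Matrix (Fin n) (Fin n) ℕ) :
    BFull K A →ₗ[K] BFull K Aᵀ :=
  tmap (DAmapF K A) (starA K π A)

/-- `Q̂_{A,i} = P̂_{A,i} ⊗ E_{A,i} E^∨_{A,i}` (the projection `P̂_{A,i}` is onto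
monomials with `(γA⁻¹)_i ≠ 0`). -/
def QhatFull (K : Type) [Field K] {n : ℕ} (π : K) (A : Matrix (Fin n) (Fin n) ℕ)
    (i : Fin n) : BFull K A →ₗ[K] BFull K A :=
  tmap (diagOp fun m : AMon A => if gamRow A m.1.1 i = 0 then (0 : K) else 1)
    ((EA K π A i).comp (EAdual K π A i))

/-- `p^{−2Q̂_A} = ∏_i (Id + (p⁻² − 1) Q̂_{A,i})` (the `Q̂_{A,i}` are commuting
idempotents). -/
def pQhatInvDiag (K : Type) [Field K] {n : ℕ} (p : ℕ) (π : K)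
    (A : Matrix (Fin n) (Fin n) ℕ) : BFull K A →ₗ[K] BFull K A :=
  ((List.finRange n).map fun i =>
    LinearMap.id + ((p : K) ^ (-2 : ℤ) - 1) • QhatFull K π A i).foldr
    (fun f g => f.comp g) LinearMap.id

/-- `#_A`: the number of indices `i` with `(γA⁻¹)_i ∉ ℤ`. -/
def hashA {n : ℕ} (A : Matrix (Fin n) (Fin n) ℕ) (q : BIdx A) : ℤ :=
  ((Finset.univ.filter fun i => ¬ ∃ z : ℤ, gamRow A q.1.1.1 i = (z : ℚ)).card : ℤ)

/-- `#^∨_A`: the number of indices `i` with `(λA⁻ᵀ)_i ∉ ℤ`. -/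
def hashAdual {n : ℕ} (A : Matrix (Fin n) (Fin n) ℕ) (q : BIdx A) : ℤ :=
  ((Finset.univ.filter fun i => ¬ ∃ z : ℤ, lamRow A q.1.1.2 i = (z : ℚ)).card : ℤ)

/-- The diagonal twist `(κπ)^{(p−1)(#_A − #^∨_A)/2}`. -/
def TwistDiag (K : Type) [Field K] {n : ℕ} (p : ℕ) (κ π : K)
    (A : Matrix (Fin n) (Fin n) ℕ) : BFull K A →ₗ[K] BFull K A :=
  diagOp fun q => (κ * π) ^ ((((p : ℤ) - 1) / 2) * (hashA A q - hashAdual A q))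

/-- The twisted Frobenius `TFr_A = Fr_A ∘ (κπ)^{(p−1)(#_A − #^∨_A)/2}`. -/
def TFrFull (K : Type) [Field K] {n : ℕ} (p : ℕ) (κ π : K)
    (A : Matrix (Fin n) (Fin n) ℕ) : BFull K A →ₗ[K] BFull K A :=
  (FrFull K p π A).comp (TwistDiag K p κ π A)
end

/-! ### Coefficients of the Dwork exponential -/

lemma dworkCoef_eq_sum (K : Type) [Field K] {p : ℕ} (hp : 0 < p) (π : K) {m N : ℕ}
    (hN : m < N) :
    dworkCoef K p π m = ∑ a ∈ Finset.range N, ∑ b ∈ Finset.range N,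
      if a + p * b = m then
        ((-1 : K) ^ a * π ^ (a + b)) / ((a.factorial : K) * (b.factorial : K)) else 0 := by
  unfold dworkCoef
  rw [← Finset.sum_product']
  apply Finset.sum_subset
  · intro x hx
    simp only [Finset.mem_product, Finset.mem_range] at hx ⊢
    omega
  · intro x _ hx
    rw [if_neg]
    intro h
    apply hx
    have : x.2 ≤ p * x.2 := Nat.le_mul_of_pos_left _ hp
    simp only [Finset.mem_product, Finset.mem_range]
    omega

lemma dworkCoef_zero (K : Type) [Field K] (p : ℕ) (π : K) : dworkCoef K p π 0 = 1 := by
  simp [dworkCoef]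

lemma dworkCoef_succ (K : Type) [Field K] [CharZero K] {p : ℕ} (hp : 0 < p) (π : K)
    (m : ℕ) :
    ((m + 1 : ℕ) : K) * dworkCoef K p π (m + 1) = -π * dworkCoef K p π m
      + if p ≤ m + 1 then π * p * dworkCoef K p π (m + 1 - p) else 0 := by
  have e1 : ((m + 1 : ℕ) : K) * dworkCoef K p π (m + 1)
      = (∑ a ∈ Finset.range (m + 3), ∑ b ∈ Finset.range (m + 3),
        if a + p * b = m + 1 then
        (a : K) * (((-1 : K) ^ a * π ^ (a + b)) / ((a.factorial : K) * (b.factorial : K)))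
          else 0)
      + ∑ a ∈ Finset.range (m + 3), ∑ b ∈ Finset.range (m + 3),
        if a + p * b = m + 1 then
        (p * b : K) * (((-1 : K) ^ a * π ^ (a + b)) / ((a.factorial : K) * (b.factorial : K)))
          else 0 := by
    rw [dworkCoef_eq_sum K hp π (show m + 1 < m + 3 by omega), Finset.mul_sum,
      ← Finset.sum_add_distrib]
    refine Finset.sum_congr rfl fun a _ => ?_
    rw [Finset.mul_sum, ← Finset.sum_add_distrib]
    refine Finset.sum_congr rfl fun b _ => ?_
    split_ifs with h
    · rw [← add_mul, ← h]
      push_cast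
      ring
    · simp
  rw [e1]
  congr 1
  · have z1 : (∑ b ∈ Finset.range (m + 3), if m + 2 + p * b = m then
        ((-1 : K) ^ (m + 2) * π ^ (m + 2 + b)) /
          (((m + 2).factorial : K) * (b.factorial : K)) else 0) = 0 :=
      Finset.sum_eq_zero fun b _ => if_neg (by omega)
    have z2 : (∑ b ∈ Finset.range (m + 3), if 0 + p * b = m + 1 then
        (((0 : ℕ) : K)) * (((-1 : K) ^ 0 * π ^ (0 + b)) /
          ((Nat.factorial 0 : K) * (b.factorial : K))) else 0) = 0 :=
      Finset.sum_eq_zero fun b _ => by simp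
    rw [Finset.sum_range_succ', z2, add_zero, dworkCoef_eq_sum K hp π (show m < m + 3 by omega),
      Finset.sum_range_succ _ (m + 2), z1, add_zero, Finset.mul_sum]
    refine Finset.sum_congr rfl fun a _ => ?_
    rw [Finset.mul_sum]
    refine Finset.sum_congr rfl fun b _ => ?_
    have : a + 1 + p * b = m + 1 ↔ a + p * b = m := by omega
    simp only [this]
    split_ifs
    · have h1 : ((a : K) + 1) ≠ 0 := by exact_mod_cast Nat.succ_ne_zero a
      have h2 : (a.factorial : K) ≠ 0 := by exact_mod_cast a.factorial_ne_zero
      have h3 : (b.factorial : K) ≠ 0 := by exact_mod_cast b.factorial_ne_zero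
      rw [Nat.factorial_succ]
      push_cast
      field_simp
      ring
    · simp
  · have hz : (∑ a ∈ Finset.range (m + 3), ∑ b ∈ Finset.range (m + 3),
        if a + p * b = m + 1 then
        (p * b : K) * (((-1 : K) ^ a * π ^ (a + b)) / ((a.factorial : K) * (b.factorial : K)))
          else 0) = ∑ a ∈ Finset.range (m + 3), ∑ b ∈ Finset.range (m + 3),
        if a + p * (b + 1) = m + 1 then
        π * p * (((-1 : K) ^ a * π ^ (a + b)) / ((a.factorial : K) * (b.factorial : K)))
          else 0 := by
      refine Finset.sum_congr rfl fun a _ => ?_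
      rw [Finset.sum_range_succ' _ (m + 2), Finset.sum_range_succ _ (m + 2)]
      have z1 : ¬ (a + p * (m + 2 + 1) = m + 1) := by
        have : m + 2 + 1 ≤ p * (m + 2 + 1) := Nat.le_mul_of_pos_left _ hp
        omega
      rw [if_neg z1]
      simp only [Nat.cast_zero, mul_zero, zero_mul, ite_self, add_zero]
      refine Finset.sum_congr rfl fun b _ => ?_
      split_ifs
      · have h1 : ((b : K) + 1) ≠ 0 := by exact_mod_cast Nat.succ_ne_zero b
        have h2 : (a.factorial : K) ≠ 0 := by exact_mod_cast a.factorial_ne_zero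
        have h3 : (b.factorial : K) ≠ 0 := by exact_mod_cast b.factorial_ne_zero
        rw [Nat.factorial_succ]
        push_cast
        field_simp
        ring
      · rfl
    rw [hz]
    split_ifs with hpm
    · rw [dworkCoef_eq_sum K hp π (show m + 1 - p < m + 3 by omega), Finset.mul_sum]
      refine Finset.sum_congr rfl fun a _ => ?_
      rw [Finset.mul_sum]
      refine Finset.sum_congr rfl fun b _ => ?_
      have : a + p * (b + 1) = m + 1 ↔ a + p * b = m + 1 - p := by
        rw [mul_add]; omega
      simp only [this]
      split_ifs <;> simp
    · refine Finset.sum_eq_zero fun a _ => Finset.sum_eq_zero fun b _ => if_neg ?_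
      rw [mul_add]; omega

/-- The integers `t_m = m! d_m / (-π)^m`, where `d_m` are the coefficients of the Dwork
exponential. -/
def dworkInt (p : ℕ) : ℕ → ℤ
  | 0 => 1
  | m + 1 => dworkInt p m +
      if _ : 0 < p ∧ p ≤ m + 1 then
        (-1) ^ (p - 1) * (m.descFactorial (p - 1) : ℤ) * dworkInt p (m + 1 - p) else 0
  termination_by m => m
  decreasing_by all_goals omega

lemma dworkInt_succ {p : ℕ} (hp : 0 < p) (m : ℕ) : dworkInt p (m + 1) = dworkInt p m +
      if p ≤ m + 1 then
        (-1) ^ (p - 1) * (m.descFactorial (p - 1) : ℤ) * dworkInt p (m + 1 - p) else 0 := by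
  rw [dworkInt]
  simp [hp]

lemma factorial_mul_dworkCoef (K : Type) [Field K] [CharZero K] {p : ℕ} (hp : 0 < p) {π : K}
    (hπ : π ^ (p - 1) = -(p : K)) (m : ℕ) :
    (m.factorial : K) * dworkCoef K p π m = (-π) ^ m * (dworkInt p m : K) := by
  induction m using Nat.strong_induction_on with
  | _ m ih =>
    cases m with
    | zero => simp [dworkCoef_zero, dworkInt]
    | succ m =>
      rw [Nat.factorial_succ, dworkInt_succ hp]
      have h1 := dworkCoef_succ K hp π m
      have h2 := ih m (by omega)
      have h3 : (((m + 1) * m.factorial : ℕ) : K) * dworkCoef K p π (m + 1)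
          = (m.factorial : K) * (((m + 1 : ℕ) : K) * dworkCoef K p π (m + 1)) := by
        push_cast; ring
      rw [h3, h1]
      split_ifs with h
      · have h4 := ih (m + 1 - p) (by omega)
        have h5 : (m.factorial : K)
            = ((m + 1 - p).factorial : K) * (m.descFactorial (p - 1) : K) := by
          have := Nat.factorial_mul_descFactorial (show p - 1 ≤ m by omega)
          rw [show m - (p - 1) = m + 1 - p by omega] at this
          exact_mod_cast this.symm
        have h6 : (-π) ^ (m + 1) = (-π) ^ (m + 1 - p) * ((-1) ^ (p - 1) * (π * p)) := by
          have : m + 1 = (m + 1 - p) + ((p - 1) + 1) := by omega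
          conv_lhs => rw [this]
          rw [pow_add, pow_succ, neg_pow π (p - 1), hπ]
          ring
        have h7 : ((-1 : K) ^ (p - 1)) * (-1) ^ (p - 1) = 1 := by
          rw [← mul_pow]; simp
        rw [mul_add, mul_left_comm, h2]
        push_cast
        rw [mul_add, pow_succ (-π) m]
        have h8 : (m.factorial : K) * (π * p * dworkCoef K p π (m + 1 - p))
            = (m.descFactorial (p - 1) : K) * (π * p) *
              ((-π) ^ (m + 1 - p) * (dworkInt p (m + 1 - p) : K)) := by
          rw [← h4, h5]; ring
        rw [pow_succ] at h6
        rw [h8]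
        linear_combination (-((-1) ^ (p - 1) * (m.descFactorial (p - 1) : K) *
          (dworkInt p (m + 1 - p) : K))) * h6 - (m.descFactorial (p - 1) : K) * (π * p) *
              ((-π) ^ (m + 1 - p) * (dworkInt p (m + 1 - p) : K)) * h7
      · rw [add_zero, mul_left_comm, h2]
        push_cast
        ring

lemma dvd_descFactorial_of_le {p k m j : ℕ} (h1 : p * k ≤ m) (h2 : m < p * k + j) :
    (p : ℤ) ∣ (m.descFactorial j : ℤ) := by
  have : p * k ∣ m.descFactorial j := by
    rw [Nat.descFactorial_eq_prod_range]
    have : m - (m - p * k) = p * k := by omega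
    conv_lhs => rw [← this]
    exact Finset.dvd_prod_of_mem (fun i => m - i) (Finset.mem_range.2 (by omega))
  exact_mod_cast (Dvd.intro _ rfl).trans this

lemma dvd_neg_one_pow_mul_descFactorial_add_one {p : ℕ} [hp : Fact p.Prime] (k : ℕ) :
    (p : ℤ) ∣ (-1) ^ (p - 1) * ((p * k + (p - 1)).descFactorial (p - 1) : ℤ) + 1 := by
  have hpos := hp.out.pos
  rw [← ZMod.intCast_zmod_eq_zero_iff_dvd, Nat.descFactorial_eq_prod_range]
  push_cast
  have h1 : ∀ i ∈ Finset.range (p - 1),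
      ((p * k + (p - 1) - i : ℕ) : ZMod p) = ((p - 1 - i : ℕ) : ZMod p) := by
    intro i hi
    rw [Finset.mem_range] at hi
    rw [show p * k + (p - 1) - i = p * k + (p - 1 - i) by omega]
    simp
  rw [Finset.prod_congr rfl h1, ← Nat.cast_prod, ← Nat.descFactorial_eq_prod_range,
    Nat.descFactorial_self, ZMod.wilsons_lemma]
  rcases hp.out.eq_two_or_odd' with h | h
  · subst h; norm_num; rfl
  · rw [Even.neg_one_pow (by obtain ⟨l, hl⟩ := h; exact ⟨l, by omega⟩)]
    simp

/-- If the `k`-th block is divisible by `p^e`, then the `(k+1)`-st block is constant modulo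
`p^(e+1)`. -/
lemma dworkInt_block {p : ℕ} [hp : Fact p.Prime] {k e : ℕ}
    (h : ∀ r < p, (p : ℤ) ^ e ∣ dworkInt p (p * k + r)) {r : ℕ} (hr : r < p) :
    (p : ℤ) ^ (e + 1) ∣ dworkInt p (p * (k + 1) + r) - dworkInt p (p * (k + 1)) := by
  have hpos := hp.out.pos
  induction r with
  | zero => simp
  | succ r ih =>
    have ih := ih (by omega)
    rw [← add_assoc, dworkInt_succ hpos, mul_add, mul_one, if_pos (by omega)]
    rw [mul_add, mul_one] at ih
    have e1 : p * k + p + r + 1 - p = p * k + (r + 1) := by omega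
    rw [e1]
    have h2 : (p : ℤ) ∣ ((p * k + p + r).descFactorial (p - 1) : ℤ) :=
      dvd_descFactorial_of_le (k := k + 1) (by rw [mul_add]; omega) (by rw [mul_add]; omega)
    have h3 : (p : ℤ) ^ (e + 1) ∣ (-1) ^ (p - 1) *
        ((p * k + p + r).descFactorial (p - 1) : ℤ) * dworkInt p (p * k + (r + 1)) := by
      rw [pow_succ', mul_assoc]
      exact Dvd.dvd.mul_left (mul_dvd_mul h2 (h _ hr)) _
    have := dvd_add ih h3
    rw [← add_sub_right_comm] at this
    exact this

lemma dworkInt_block_two {p : ℕ} [hp : Fact p.Prime] {k e : ℕ}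
    (h0 : ∀ r < p, (p : ℤ) ^ e ∣ dworkInt p (p * k + r))
    (h1 : ∀ r < p, (p : ℤ) ^ e ∣ dworkInt p (p * (k + 1) + r)) {r : ℕ} (hr : r < p) :
    (p : ℤ) ^ (e + 1) ∣ dworkInt p (p * (k + 2) + r) := by
  have hpos := hp.out.pos
  have key := dworkInt_block h1 hr
  rw [show k + 1 + 1 = k + 2 by ring] at key
  suffices hs : (p : ℤ) ^ (e + 1) ∣ dworkInt p (p * (k + 2)) by
    simpa using dvd_add key hs
  have e2 : p * (k + 2) = p * (k + 1) + (p - 1) + 1 := by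
    rw [mul_add, mul_add]; omega
  rw [e2, dworkInt_succ hpos, if_pos (by omega),
    show p * (k + 1) + (p - 1) + 1 - p = p * (k + 1) by omega]
  have h3 := dworkInt_block h0 (r := p - 1) (by omega)
  have h4 := dvd_neg_one_pow_mul_descFactorial_add_one (p := p) (k + 1)
  have h5 := h1 0 hpos
  have h6 := mul_dvd_mul h4 h5
  rw [← pow_succ'] at h6
  have := dvd_add h3 h6
  rw [add_zero, add_one_mul, sub_add_add_cancel] at this
  exact this

lemma pow_dvd_dworkInt {p : ℕ} [hp : Fact p.Prime] (k : ℕ) :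
    (∀ r < p, (p : ℤ) ^ k ∣ dworkInt p (p * (2 * k) + r)) ∧
    (∀ r < p, (p : ℤ) ^ k ∣ dworkInt p (p * (2 * k + 1) + r)) := by
  induction k with
  | zero => simp
  | succ k ih =>
    have h2 : ∀ r < p, (p : ℤ) ^ (k + 1) ∣ dworkInt p (p * (2 * k + 2) + r) :=
      fun r hr => dworkInt_block_two ih.1 ih.2 hr
    refine ⟨h2, fun r hr => ?_⟩
    have := dworkInt_block_two ih.2 (e := k) (fun r hr => (Dvd.intro _ (pow_succ _ _).symm).trans
      (h2 r hr)) hr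
    exact this

lemma pow_div_dvd_dworkInt {p : ℕ} [hp : Fact p.Prime] (m : ℕ) :
    (p : ℤ) ^ (m / (2 * p)) ∣ dworkInt p m := by
  have hpos := hp.out.pos
  have h1 := Nat.div_add_mod m (2 * p)
  have h2 := Nat.mod_lt m (show 0 < 2 * p by omega)
  obtain ⟨ha, hb⟩ := pow_dvd_dworkInt (p := p) (m / (2 * p))
  by_cases h : m % (2 * p) < p
  · have := ha _ h
    convert this using 2
    rw [← mul_assoc, mul_comm p 2, h1]
  · have := hb (m % (2 * p) - p) (by omega)
    convert this using 2
    rw [mul_add, ← mul_assoc, mul_comm p 2]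
    omega

section NormBounds

variable {p : ℕ} [hp : Fact p.Prime] {K : Type} [NontriviallyNormedField K]

lemma norm_natCast_le_one_of_nonarch (hna : ∀ a b : K, ‖a + b‖ ≤ max ‖a‖ ‖b‖) (m : ℕ) :
    ‖(m : K)‖ ≤ 1 := by
  induction m with
  | zero => simp
  | succ m ih =>
    push_cast
    exact (hna _ _).trans (by simp [ih])

lemma norm_intCast_le_one_of_nonarch (hna : ∀ a b : K, ‖a + b‖ ≤ max ‖a‖ ‖b‖) (m : ℤ) :
    ‖(m : K)‖ ≤ 1 := by
  obtain ⟨k, rfl | rfl⟩ := m.eq_nat_or_neg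
  · simpa using norm_natCast_le_one_of_nonarch hna k
  · simpa using norm_natCast_le_one_of_nonarch hna k

lemma norm_natCast_eq_one_of_coprime (hna : ∀ a b : K, ‖a + b‖ ≤ max ‖a‖ ‖b‖)
    (hpnorm : ‖(p : K)‖ = (p : ℝ)⁻¹) {m : ℕ} (hm : p.Coprime m) : ‖(m : K)‖ = 1 := by
  apply le_antisymm (norm_natCast_le_one_of_nonarch hna m)
  by_contra! hlt
  have hb := Nat.gcd_eq_gcd_ab p m
  rw [hm.gcd_eq_one] at hb
  have hb' : (1 : K) = (p : K) * (p.gcdA m : K) + (m : K) * (p.gcdB m : K) := by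
    exact_mod_cast congrArg (fun z : ℤ => (z : K)) hb
  have h1 := hna ((p : K) * (p.gcdA m : K)) ((m : K) * (p.gcdB m : K))
  rw [← hb', norm_one, norm_mul, norm_mul, hpnorm] at h1
  have hp1 : ((p : ℝ)⁻¹) < 1 := inv_lt_one_of_one_lt₀ (by exact_mod_cast hp.out.one_lt)
  have hp0 : 0 ≤ ((p : ℝ)⁻¹) := by positivity
  have ha := norm_intCast_le_one_of_nonarch hna (p.gcdA m)
  have hb := norm_intCast_le_one_of_nonarch hna (p.gcdB m)
  have : max ((p : ℝ)⁻¹ * ‖(p.gcdA m : K)‖) (‖(m : K)‖ * ‖(p.gcdB m : K)‖) < 1 := by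
    apply max_lt
    · nlinarith
    · nlinarith [norm_nonneg (m : K)]
  linarith

lemma norm_pow_le_norm_factorial (hna : ∀ a b : K, ‖a + b‖ ≤ max ‖a‖ ‖b‖)
    (hpnorm : ‖(p : K)‖ = (p : ℝ)⁻¹) {π : K} (hπ : π ^ (p - 1) = -(p : K)) (m : ℕ) :
    ‖π‖ ^ m ≤ ‖(m.factorial : K)‖ := by
  have hp2 := hp.out.two_le
  obtain ⟨v, u, hu, hmu⟩ := Nat.exists_eq_pow_mul_and_not_dvd m.factorial_ne_zero p hp.out.ne_one
  have hu0 : u ≠ 0 := by rintro rfl; simp at hu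
  have hv : padicValNat p m.factorial = v := by
    rw [hmu, padicValNat.mul (pow_ne_zero _ hp.out.ne_zero) hu0, padicValNat.prime_pow,
      padicValNat.eq_zero_of_not_dvd hu, add_zero]
  have hle : (p - 1) * v ≤ m := by
    rw [← hv, sub_one_mul_padicValNat_factorial]; exact Nat.sub_le _ _
  have hn : ‖(m.factorial : K)‖ = ‖(p : K)‖ ^ v := by
    rw [hmu]
    push_cast
    rw [norm_mul, norm_pow, norm_natCast_eq_one_of_coprime hna hpnorm
      ((Nat.Prime.coprime_iff_not_dvd hp.out).2 hu), mul_one]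
  have hπp : ‖π‖ ^ (p - 1) = ‖(p : K)‖ := by rw [← norm_pow, hπ, norm_neg]
  rw [hn, ← hπp, ← pow_mul]
  refine pow_le_pow_of_le_one (norm_nonneg _) ?_ hle
  by_contra! h1
  have h2 : 1 < ‖π‖ ^ (p - 1) := one_lt_pow₀ h1 (by omega)
  rw [hπp] at h2
  exact absurd h2 (not_lt.2 (norm_natCast_le_one_of_nonarch hna p))

/-- The coefficients of the Dwork exponential decay geometrically. -/
lemma exists_norm_dworkCoef_le [CharZero K] (hna : ∀ a b : K, ‖a + b‖ ≤ max ‖a‖ ‖b‖)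
    (hpnorm : ‖(p : K)‖ = (p : ℝ)⁻¹) {π : K} (hπ : π ^ (p - 1) = -(p : K)) :
    ∃ C r : ℝ, 1 ≤ C ∧ 0 < r ∧ r < 1 ∧ ∀ m, ‖dworkCoef K p π m‖ ≤ C * r ^ m := by
  have hp1 : (1 : ℝ) < p := by exact_mod_cast hp.out.one_lt
  have hp0 : (0 : ℝ) < p := by positivity
  have hne : 2 * p ≠ 0 := by have := hp.out.pos; omega
  set r : ℝ := ((p : ℝ)⁻¹) ^ ((2 * p : ℕ) : ℝ)⁻¹ with hr
  have hr0 : 0 < r := by positivity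
  have hr1 : r < 1 := Real.rpow_lt_one (by positivity) (inv_lt_one_of_one_lt₀ hp1) (by positivity)
  have hrp : r ^ (2 * p) = (p : ℝ)⁻¹ := Real.rpow_inv_natCast_pow (by positivity) hne
  refine ⟨(p : ℝ), r, hp1.le, hr0, hr1, fun m => ?_⟩
  have hf := norm_pow_le_norm_factorial hna hpnorm hπ m
  have hπ0 : π ≠ 0 := by
    rintro rfl
    have h := congrArg norm hπ
    rw [norm_neg, hpnorm, zero_pow (by have := hp.out.two_le; omega), norm_zero] at h
    exact absurd h.symm (by positivity)
  have hfac := congrArg norm (factorial_mul_dworkCoef K hp.out.pos hπ m)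
  rw [norm_mul, norm_mul, norm_pow, norm_neg] at hfac
  have hπn : 0 < ‖π‖ ^ m := by have := norm_pos_iff.2 hπ0; positivity
  have h1 : ‖dworkCoef K p π m‖ ≤ ‖(dworkInt p m : K)‖ := by
    have : ‖π‖ ^ m * ‖dworkCoef K p π m‖ ≤ ‖π‖ ^ m * ‖(dworkInt p m : K)‖ := by
      rw [← hfac]; gcongr
    exact le_of_mul_le_mul_left this hπn
  obtain ⟨z, hz⟩ := pow_div_dvd_dworkInt (p := p) m
  have h2 : ‖(dworkInt p m : K)‖ ≤ ((p : ℝ)⁻¹) ^ (m / (2 * p)) := by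
    rw [hz]
    push_cast
    rw [norm_mul, norm_pow, hpnorm]
    exact mul_le_of_le_one_right (by positivity) (norm_intCast_le_one_of_nonarch hna z)
  refine h1.trans (h2.trans ?_)
  rw [← hrp, ← pow_mul]
  have h3 : r ^ (2 * p * (m / (2 * p)) + 2 * p) ≤ r ^ m := by
    apply pow_le_pow_of_le_one hr0.le hr1.le
    have := Nat.div_add_mod m (2 * p)
    have := Nat.mod_lt m (show 0 < 2 * p by omega)
    omega
  rw [pow_add, hrp] at h3
  calc _ = (p : ℝ) * (r ^ (2 * p * (m / (2 * p))) * (p : ℝ)⁻¹) := by field_simp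
    _ ≤ _ := by gcongr

end NormBounds

/-! ### The canonical anticommutation relations -/

section Exterior

variable {F : Type} [Field F]

/-- `v` is homogeneous of degree `k`. -/
def ExtHomogeneous {ι : Type} (k : ℤ) (v : ExtV F ι) : Prop :=
  ∀ S, v S ≠ 0 → (S.card : ℤ) = k

lemma ExtHomogeneous.smul_sum {ι : Type} [Fintype ι] {k : ℤ} {v : ι → ExtV F ι} (hv : ∀ j, ExtHomogeneous k (v j))
    (a : F) (b : ι → F) : ExtHomogeneous k (a • ∑ j, b j • v j) := by
  intro S hS
  simp only [Pi.smul_apply, Finset.sum_apply, smul_eq_mul] at hS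
  obtain ⟨j, -, hj⟩ := Finset.exists_ne_zero_of_sum_ne_zero (right_ne_zero_of_mul hS)
  exact hv j S (right_ne_zero_of_mul hj)

section Sign

variable {ι : Type} [LinearOrder ι]

lemma neg_one_pow_card_filter_erase {i j : ι} (S : Finset ι) (hi : i ∈ S) :
    (-1 : F) ^ ((S.erase i).filter (· < j)).card
      = (if i < j then -1 else 1) * (-1 : F) ^ (S.filter (· < j)).card := by
  rw [Finset.filter_erase]
  split_ifs with h
  · have : i ∈ S.filter (· < j) := Finset.mem_filter.2 ⟨hi, h⟩
    rw [← Finset.card_erase_add_one this, pow_succ]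
    ring
  · rw [Finset.erase_eq_of_notMem (by simp [h]), one_mul]

lemma neg_one_pow_card_filter_insert {i j : ι} (S : Finset ι) (hi : i ∉ S) :
    (-1 : F) ^ ((insert i S).filter (· < j)).card
      = (if i < j then -1 else 1) * (-1 : F) ^ (S.filter (· < j)).card := by
  have := neg_one_pow_card_filter_erase (F := F) (j := j) (insert i S) (Finset.mem_insert_self _ _)
  rw [Finset.erase_insert hi] at this
  rw [this]
  split_ifs <;> simp

lemma card_filter_erase_self (i : ι) (S : Finset ι) :
    ((S.erase i).filter (· < i)).card = (S.filter (· < i)).card := by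
  rw [Finset.filter_erase, Finset.erase_eq_of_notMem (by simp)]

lemma card_filter_insert_self (i : ι) (S : Finset ι) :
    ((insert i S).filter (· < i)).card = (S.filter (· < i)).card := by
  rw [Finset.filter_insert, if_neg (lt_irrefl i)]

lemma mulE_apply (i : ι) (f : ExtV F ι) (S : Finset ι) :
    mulE F i f S = if i ∈ S then (-1 : F) ^ (S.filter (· < i)).card * f (S.erase i) else 0 := rfl

lemma contrE_apply (i : ι) (f : ExtV F ι) (S : Finset ι) :
    contrE F i f S
      = if i ∈ S then 0 else (-1 : F) ^ (S.filter (· < i)).card * f (insert i S) := rfl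

lemma mulE_mulE (i j : ι) (f : ExtV F ι) :
    mulE F i (mulE F j f) = -mulE F j (mulE F i f) := by
  funext S
  rw [Pi.neg_apply]
  simp only [mulE_apply]
  rcases eq_or_ne i j with rfl | hij
  · simp
  by_cases hi : i ∈ S <;> by_cases hj : j ∈ S <;>
    simp only [hi, hj, if_true, if_false, Finset.mem_erase, ne_eq, hij, hij.symm,
      not_false_eq_true, true_and, mul_zero, neg_zero, and_false]
  rw [neg_one_pow_card_filter_erase S hi, neg_one_pow_card_filter_erase S hj,
    Finset.erase_right_comm]
  rcases lt_or_gt_of_ne hij with h | h <;> simp only [h, h.not_gt, if_true, if_false] <;> ring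

lemma contrE_contrE (i j : ι) (f : ExtV F ι) :
    contrE F i (contrE F j f) = -contrE F j (contrE F i f) := by
  funext S
  rw [Pi.neg_apply]
  simp only [contrE_apply]
  rcases eq_or_ne i j with rfl | hij
  · simp
  by_cases hi : i ∈ S <;> by_cases hj : j ∈ S <;>
    simp only [hi, hj, if_true, if_false, Finset.mem_insert, hij, hij.symm, or_self, or_true,
      mul_zero, neg_zero]
  rw [neg_one_pow_card_filter_insert S hi, neg_one_pow_card_filter_insert S hj,
    Finset.insert_comm]
  rcases lt_or_gt_of_ne hij with h | h <;> simp only [h, h.not_gt, if_true, if_false] <;> ring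

lemma neg_one_pow_mul_self_eq_one (m : ℕ) : (-1 : F) ^ m * (-1) ^ m = 1 := by
  rw [← mul_pow]; simp

lemma mulE_contrE (i j : ι) (f : ExtV F ι) :
    mulE F i (contrE F j f) + contrE F j (mulE F i f) = if i = j then f else 0 := by
  funext S
  rw [Pi.add_apply]
  simp only [contrE_apply, mulE_apply]
  rcases eq_or_ne i j with rfl | hij
  · by_cases hi : i ∈ S
    · simp only [hi, if_true, Finset.mem_erase, ne_eq, not_true_eq_false, false_and, if_false,
        card_filter_erase_self, Finset.insert_erase hi, add_zero]
      rw [← mul_assoc, neg_one_pow_mul_self_eq_one, one_mul]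
    · simp only [hi, if_true, Finset.mem_insert, or_false, if_false,
        card_filter_insert_self, Finset.erase_insert hi, zero_add]
      rw [← mul_assoc, neg_one_pow_mul_self_eq_one, one_mul]
  · rw [if_neg hij]
    by_cases hi : i ∈ S <;> by_cases hj : j ∈ S <;>
      simp only [hi, hj, if_true, if_false, Finset.mem_insert, Finset.mem_erase, hij, hij.symm,
        or_self, or_true, mul_zero, add_zero, ne_eq, not_false_eq_true, true_and, and_false,
        Pi.zero_apply]
    rw [neg_one_pow_card_filter_erase S hi, neg_one_pow_card_filter_insert S hj,
      Finset.erase_insert_of_ne hij.symm]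
    rcases lt_or_gt_of_ne hij with h | h <;> simp only [h, h.not_gt, if_true, if_false] <;> ring

lemma mulE_single (i : ι) (S : Finset ι) (hi : i ∉ S) :
    mulE F i (Pi.single S 1)
      = (-1 : F) ^ (S.filter (· < i)).card • Pi.single (insert i S) (1 : F) := by
  funext T
  simp only [mulE_apply, Pi.smul_apply, smul_eq_mul, Pi.single_apply]
  by_cases hT : T = insert i S
  · subst hT
    simp [card_filter_insert_self, Finset.erase_insert hi]
  · rw [if_neg hT, mul_zero]
    split_ifs with h1 h2
    · exact absurd (by rw [← h2, Finset.insert_erase h1]) hT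
    · simp
    · rfl

lemma mulE_single_of_mem (i : ι) (S : Finset ι) (hi : i ∈ S) :
    mulE F i (Pi.single S 1) = 0 := by
  funext T
  simp only [mulE_apply, Pi.single_apply, Pi.zero_apply]
  split_ifs with h1 h2
  · subst h2; simp at hi
  · simp
  · rfl

lemma contrE_single_empty (i : ι) : contrE F i (Pi.single ∅ 1) = 0 := by
  funext T
  simp [contrE_apply]

lemma mulE_single_of_lt {a : ι} {S : Finset ι} (ha : ∀ b ∈ S, a < b) :
    mulE F a (Pi.single S 1) = Pi.single (insert a S) 1 := by
  rw [mulE_single a S (fun h => lt_irrefl _ (ha a h)), Finset.filter_false_of_mem]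
  · simp
  · exact fun b hb => (ha b hb).not_gt

lemma ExtHomogeneous.mulE {k : ℤ} {v : ExtV F ι} (hv : ExtHomogeneous k v) (i : ι) :
    ExtHomogeneous (k + 1) (mulE F i v) := by
  intro S hS
  rw [mulE_apply] at hS
  split_ifs at hS with h
  · have := hv _ (right_ne_zero_of_mul hS)
    rw [← Finset.card_erase_add_one h]
    push_cast
    omega
  · exact absurd rfl hS

lemma ExtHomogeneous.contrE {k : ℤ} {v : ExtV F ι} (hv : ExtHomogeneous k v) (i : ι) :
    ExtHomogeneous (k - 1) (contrE F i v) := by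
  intro S hS
  rw [contrE_apply] at hS
  split_ifs at hS with h
  · exact absurd rfl hS
  · have := hv _ (right_ne_zero_of_mul hS)
    rw [Finset.card_insert_of_notMem h] at this
    push_cast at this
    omega

end Sign

variable {ι : Type} [Fintype ι] [LinearOrder ι]

lemma EA_apply (π : F) (A : Matrix ι ι ℕ) (i : ι) (v : ExtV F ι) :
    EA F π A i v = π • ∑ j, (A i j : F) • mulE F j v := by
  simp [EA]

lemma EAdual_apply (π : F) (A : Matrix ι ι ℕ) (i : ι) (v : ExtV F ι) :
    EAdual F π A i v = π⁻¹ • ∑ j, ((A.map ((↑) : ℕ → F))⁻¹ j i) • contrE F j v := by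
  simp [EAdual]

lemma EA_EA (π : F) (A : Matrix ι ι ℕ) (i j : ι) (v : ExtV F ι) :
    EA F π A i (EA F π A j v) = -EA F π A j (EA F π A i v) := by
  simp only [EA_apply, map_smul, map_sum, Finset.smul_sum, ← Finset.sum_neg_distrib]
  rw [Finset.sum_comm]
  refine Finset.sum_congr rfl fun k _ => Finset.sum_congr rfl fun l _ => ?_
  rw [mulE_mulE l k]
  simp only [smul_neg, smul_smul]
  ring_nf

lemma EAdual_EAdual (π : F) (A : Matrix ι ι ℕ) (i j : ι) (v : ExtV F ι) :
    EAdual F π A i (EAdual F π A j v) = -EAdual F π A j (EAdual F π A i v) := by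
  simp only [EAdual_apply, map_smul, map_sum, Finset.smul_sum, ← Finset.sum_neg_distrib]
  rw [Finset.sum_comm]
  refine Finset.sum_congr rfl fun k _ => Finset.sum_congr rfl fun l _ => ?_
  rw [contrE_contrE l k]
  simp only [smul_neg, smul_smul]
  ring_nf

lemma EA_EAdual {π : F} (hπ : π ≠ 0) {A : Matrix ι ι ℕ}
    (hA : (A.map ((↑) : ℕ → F)).det ≠ 0) (i j : ι) (v : ExtV F ι) :
    EA F π A i (EAdual F π A j v) + EAdual F π A j (EA F π A i v)
      = if i = j then v else 0 := by
  simp only [EA_apply, EAdual_apply, map_smul, map_sum, Finset.smul_sum]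
  rw [Finset.sum_comm (f := fun k l => π⁻¹ • _), ← Finset.sum_add_distrib]
  have h : ∀ k l, π⁻¹ • ((A.map ((↑) : ℕ → F))⁻¹ l j) • π • (A i k : F) •
        mulE F k (contrE F l v)
      + π • (A i k : F) • π⁻¹ • ((A.map ((↑) : ℕ → F))⁻¹ l j) • contrE F l (mulE F k v)
      = if k = l then ((A i k : F) * ((A.map ((↑) : ℕ → F))⁻¹ l j)) • v else 0 := by
    intro k l
    have e1 : π * (A i k * (π⁻¹ * (A.map ((↑) : ℕ → F))⁻¹ l j))
        = A i k * (A.map ((↑) : ℕ → F))⁻¹ l j := by field_simp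
    have e2 : π⁻¹ * ((A.map ((↑) : ℕ → F))⁻¹ l j * (π * A i k))
        = A i k * (A.map ((↑) : ℕ → F))⁻¹ l j := by field_simp
    simp only [smul_smul]
    simp only [e1, e2]
    rw [← smul_add, mulE_contrE]
    split_ifs <;> simp
  simp only [← Finset.sum_add_distrib, h, Finset.sum_ite_eq, Finset.mem_univ, if_true]
  rw [← Finset.sum_smul]
  have : ∑ k, (A i k : F) * (A.map ((↑) : ℕ → F))⁻¹ k j = (1 : Matrix ι ι F) i j := by
    rw [← Matrix.mul_nonsing_inv _ (isUnit_iff_ne_zero.2 hA), Matrix.mul_apply]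
    rfl
  rw [this, Matrix.one_apply]
  split_ifs <;> simp

lemma EA_self_self [CharZero F] (π : F) (A : Matrix ι ι ℕ) (i : ι) (v : ExtV F ι) :
    EA F π A i (EA F π A i v) = 0 :=
  self_eq_neg.1 (EA_EA π A i i v)

lemma EAdual_self_self [CharZero F] (π : F) (A : Matrix ι ι ℕ) (i : ι) (v : ExtV F ι) :
    EAdual F π A i (EAdual F π A i v) = 0 :=
  self_eq_neg.1 (EAdual_EAdual π A i i v)

lemma EA_foldr_eq_zero [CharZero F] (π : F) (A : Matrix ι ι ℕ) (i : ι) (v : ExtV F ι)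
    (l : List ι) (hi : i ∈ l) : EA F π A i (l.foldr (fun i v => EA F π A i v) v) = 0 := by
  induction l with
  | nil => simp at hi
  | cons a l ih =>
    rw [List.foldr_cons]
    rcases List.mem_cons.1 hi with rfl | h
    · exact EA_self_self π A i _
    · rw [EA_EA, ih h, map_zero, neg_zero]

lemma EA_starTop [CharZero F] (π : F) (A : Matrix ι ι ℕ) (i : ι) :
    EA F π Aᵀ i (starTop F π A) = 0 :=
  EA_foldr_eq_zero π Aᵀ i _ _ (by simp)

lemma starA_single (π : F) (A : Matrix ι ι ℕ) (S : Finset ι) :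
    starA F π A (Pi.single S 1)
      = (S.sort (· ≤ ·)).foldr (fun i v => EAdual F π Aᵀ i v) (starTop F π A) := by
  rw [starA, ← Pi.basisFun_apply, Module.Basis.constr_basis]

lemma starA_single_empty (π : F) (A : Matrix ι ι ℕ) :
    starA F π A (Pi.single ∅ 1) = starTop F π A := by
  rw [starA_single]; simp

lemma starA_single_insert (π : F) (A : Matrix ι ι ℕ) {a : ι} {S : Finset ι}
    (ha : ∀ b ∈ S, a < b) :
    starA F π A (Pi.single (insert a S) 1) = EAdual F π Aᵀ a (starA F π A (Pi.single S 1)) := by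
  rw [starA_single, starA_single, Finset.sort_insert _ (fun b hb => (ha b hb).le)
    (fun h => lt_irrefl _ (ha a h)), List.foldr_cons]

lemma starA_mulE_single_of_lt (π : F) (A : Matrix ι ι ℕ) {a : ι} {S : Finset ι}
    (ha : ∀ b ∈ S, a < b) :
    starA F π A (mulE F a (Pi.single S 1)) = EAdual F π Aᵀ a (starA F π A (Pi.single S 1)) := by
  rw [mulE_single_of_lt ha, starA_single_insert π A ha]

lemma starA_mulE_single [CharZero F] (π : F) (A : Matrix ι ι ℕ) (i : ι) (S : Finset ι) :
    starA F π A (mulE F i (Pi.single S 1)) = EAdual F π Aᵀ i (starA F π A (Pi.single S 1)) := by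
  induction S using Finset.induction_on_min with
  | empty => exact starA_mulE_single_of_lt π A (by simp)
  | insert a S ha ih =>
    rcases lt_trichotomy i a with h | rfl | h
    · refine starA_mulE_single_of_lt π A fun b hb => ?_
      rcases Finset.mem_insert.1 hb with rfl | hb
      · exact h
      · exact h.trans (ha b hb)
    · rw [mulE_single_of_mem _ _ (Finset.mem_insert_self _ _), map_zero,
        starA_single_insert π A ha, EAdual_self_self]
    · rw [starA_single_insert π A ha, EAdual_EAdual, ← ih, ← mulE_single_of_lt ha, mulE_mulE,
        map_neg]
      congr 1
      by_cases hi : i ∈ S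
      · rw [mulE_single_of_mem i S hi]; simp
      · rw [mulE_single i S hi, map_smul, map_smul, map_smul, map_smul, starA_mulE_single_of_lt]
        intro b hb
        rcases Finset.mem_insert.1 hb with rfl | hb
        · exact h
        · exact ha b hb

lemma linearMap_ext_single {V : Type} [AddCommGroup V] [Module F V]
    {f g : ExtV F ι →ₗ[F] V} (h : ∀ S, f (Pi.single S 1) = g (Pi.single S 1)) : f = g :=
  (Pi.basisFun F (Finset ι)).ext fun S => by simpa using h S

lemma starA_mulE [CharZero F] (π : F) (A : Matrix ι ι ℕ) (i : ι) (v : ExtV F ι) :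
    starA F π A (mulE F i v) = EAdual F π Aᵀ i (starA F π A v) := by
  have : (starA F π A).comp (mulE F i) = (EAdual F π Aᵀ i).comp (starA F π A) :=
    linearMap_ext_single fun S => starA_mulE_single π A i S
  exact LinearMap.congr_fun this v

lemma det_transpose_map_ne_zero {A : Matrix ι ι ℕ} (hA : (A.map ((↑) : ℕ → F)).det ≠ 0) :
    (Aᵀ.map ((↑) : ℕ → F)).det ≠ 0 := by
  rw [Matrix.transpose_map, Matrix.det_transpose]; exact hA

lemma starA_contrE [CharZero F] {π : F} (hπ : π ≠ 0) {A : Matrix ι ι ℕ}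
    (hA : (A.map ((↑) : ℕ → F)).det ≠ 0) (i : ι) (v : ExtV F ι) :
    starA F π A (contrE F i v) = EA F π Aᵀ i (starA F π A v) := by
  have : (starA F π A).comp (contrE F i) = (EA F π Aᵀ i).comp (starA F π A) := by
    refine linearMap_ext_single fun S => ?_
    simp only [LinearMap.comp_apply]
    induction S using Finset.induction_on_min with
    | empty => rw [contrE_single_empty, map_zero, starA_single_empty, EA_starTop]
    | insert a S ha ih =>
      have h1 := mulE_contrE a i (Pi.single S (1 : F))
      have h2 := EA_EAdual hπ (det_transpose_map_ne_zero hA) i a (starA F π A (Pi.single S 1))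
      rw [← mulE_single_of_lt ha, eq_sub_of_add_eq' h1, map_sub, starA_mulE, starA_mulE, ih,
        eq_sub_of_add_eq h2]
      congr 1
      by_cases h : i = a
      · simp [h]
      · simp [h, Ne.symm h]
  exact LinearMap.congr_fun this v

lemma starA_EA [CharZero F] {π : F} (hπ : π ≠ 0) {A : Matrix ι ι ℕ}
    (hA : (A.map ((↑) : ℕ → F)).det ≠ 0) (i : ι) (v : ExtV F ι) :
    starA F π A (EA F π A i v) = contrE F i (starA F π A v) := by
  simp only [EA_apply, map_smul, map_sum, starA_mulE, EAdual_apply, Finset.smul_sum]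
  rw [Finset.sum_comm]
  have hinv : ∀ j k, (Aᵀ.map ((↑) : ℕ → F))⁻¹ k j = (A.map ((↑) : ℕ → F))⁻¹ j k := by
    intro j k
    rw [Matrix.transpose_map, ← Matrix.transpose_nonsing_inv]; rfl
  have h1 : ∀ k, ∑ j, (A i j : F) * (A.map ((↑) : ℕ → F))⁻¹ j k = (1 : Matrix ι ι F) i k := by
    intro k
    rw [← Matrix.mul_nonsing_inv _ (isUnit_iff_ne_zero.2 hA), Matrix.mul_apply]
    rfl
  have h2 : ∀ k, ∑ j, π • (A i j : F) • π⁻¹ • (Aᵀ.map ((↑) : ℕ → F))⁻¹ k j •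
      contrE F k (starA F π A v) = (1 : Matrix ι ι F) i k • contrE F k (starA F π A v) := by
    intro k
    rw [← h1, Finset.sum_smul]
    refine Finset.sum_congr rfl fun j _ => ?_
    rw [hinv]
    simp only [smul_smul]
    congr 1
    field_simp
  simp only [h2, Matrix.one_apply, ite_smul, one_smul, zero_smul, Finset.sum_ite_eq,
    Finset.mem_univ, if_true]

lemma starA_EAdual [CharZero F] {π : F} (hπ : π ≠ 0) {A : Matrix ι ι ℕ}
    (hA : (A.map ((↑) : ℕ → F)).det ≠ 0) (i : ι) (v : ExtV F ι) :
    starA F π A (EAdual F π A i v) = mulE F i (starA F π A v) := by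
  simp only [EAdual_apply, map_smul, map_sum, starA_contrE hπ hA, EA_apply, Finset.smul_sum]
  rw [Finset.sum_comm]
  have h1 : ∀ k, ∑ j, (A k j : F) * (A.map ((↑) : ℕ → F))⁻¹ j i = (1 : Matrix ι ι F) k i := by
    intro k
    rw [← Matrix.mul_nonsing_inv _ (isUnit_iff_ne_zero.2 hA), Matrix.mul_apply]
    rfl
  have h2 : ∀ k, ∑ j, π⁻¹ • (A.map ((↑) : ℕ → F))⁻¹ j i • π • (Aᵀ j k : F) •
      mulE F k (starA F π A v) = (1 : Matrix ι ι F) k i • mulE F k (starA F π A v) := by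
    intro k
    rw [← h1, Finset.sum_smul]
    refine Finset.sum_congr rfl fun j _ => ?_
    simp only [smul_smul, Matrix.transpose_apply]
    congr 1
    field_simp
  simp only [h2, Matrix.one_apply, ite_smul, one_smul, zero_smul, Finset.sum_ite_eq',
    Finset.mem_univ, if_true]

lemma extHomogeneous_EA {k : ℤ} {v : ExtV F ι} (hv : ExtHomogeneous k v) (π : F)
    (A : Matrix ι ι ℕ) (i : ι) : ExtHomogeneous (k + 1) (EA F π A i v) := by
  rw [EA_apply]; exact ExtHomogeneous.smul_sum (fun j => hv.mulE j) _ _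

lemma extHomogeneous_EAdual {k : ℤ} {v : ExtV F ι} (hv : ExtHomogeneous k v) (π : F)
    (A : Matrix ι ι ℕ) (i : ι) : ExtHomogeneous (k - 1) (EAdual F π A i v) := by
  rw [EAdual_apply]; exact ExtHomogeneous.smul_sum (fun j => hv.contrE j) _ _

lemma extHomogeneous_starA_single (π : F) (A : Matrix ι ι ℕ) (S : Finset ι) :
    ExtHomogeneous ((Fintype.card ι : ℤ) - S.card) (starA F π A (Pi.single S 1)) := by
  have h1 : ∀ l : List ι, ExtHomogeneous (l.length : ℤ)
      (l.foldr (fun i v => EA F π Aᵀ i v) (Pi.single (∅ : Finset ι) (1 : F))) := by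
    intro l
    induction l with
    | nil =>
      intro T hT
      rw [List.foldr_nil, Pi.single_apply] at hT
      have : T = ∅ := by by_contra h; simp [h] at hT
      simp [this]
    | cons a l ih =>
      rw [List.foldr_cons, List.length_cons, Nat.cast_succ]
      exact extHomogeneous_EA ih π Aᵀ a
  have h2 : ∀ l : List ι, ExtHomogeneous ((Fintype.card ι : ℤ) - l.length)
      (l.foldr (fun i v => EAdual F π Aᵀ i v) (starTop F π A)) := by
    intro l
    induction l with
    | nil =>
      have := h1 (Finset.univ.sort (· ≤ ·))
      rw [Finset.length_sort, Finset.card_univ] at this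
      simpa [starTop] using this
    | cons a l ih =>
      rw [List.foldr_cons, List.length_cons, Nat.cast_succ, ← sub_sub]
      exact extHomogeneous_EAdual ih π Aᵀ a
  rw [starA_single]
  have := h2 (S.sort (· ≤ ·))
  rwa [Finset.length_sort] at this

lemma starA_apply_eq_sum (π : F) (A : Matrix ι ι ℕ) (v : ExtV F ι) (T : Finset ι) :
    starA F π A v T = ∑ S, starA F π A (Pi.single S 1) T * v S := by
  conv_lhs => rw [pi_eq_sum_univ' v]
  simp only [map_sum, map_smul, Finset.sum_apply, Pi.smul_apply, smul_eq_mul]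
  refine Finset.sum_congr rfl fun S _ => ?_
  rw [mul_comm]

/-- The star operator intertwines the product of the operators
`1 + a_i E_i E_i^∨` with the diagonal operator `∏ i ∉ T, (1 + a_i)`. -/
lemma starA_foldr [CharZero F] {π : F} (hπ : π ≠ 0) {A : Matrix ι ι ℕ}
    (hA : (A.map ((↑) : ℕ → F)).det ≠ 0) (a : ι → F) (l : List ι) (v : ExtV F ι)
    (T : Finset ι) :
    starA F π A (l.foldr (fun i v => v + a i • EA F π A i (EAdual F π A i v)) v) T
      = (l.map fun i => if i ∈ T then 1 else 1 + a i).prod * starA F π A v T := by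
  induction l with
  | nil => simp
  | cons i l ih =>
    rw [List.foldr_cons, map_add, map_smul, starA_EA hπ hA, starA_EAdual hπ hA, Pi.add_apply,
      Pi.smul_apply, smul_eq_mul, List.map_cons, List.prod_cons, contrE_apply, mulE_apply]
    by_cases h : i ∈ T
    · simp [h, ih]
    · simp only [h, if_false, Finset.mem_insert_self, if_true, card_filter_insert_self,
        Finset.erase_insert h]
      rw [← mul_assoc ((-1 : F) ^ _), neg_one_pow_mul_self_eq_one, one_mul, ih]
      ring

end Exterior

/-! ### The rational coordinates of a monomial -/

section Coordinates

variable {n : ℕ} {A : Matrix (Fin n) (Fin n) ℕ}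

lemma lamRow_eq_gamRow_transpose (A : Matrix (Fin n) (Fin n) ℕ) (lam : Fin n → ℕ) :
    lamRow A lam = gamRow Aᵀ lam := rfl

lemma gamRow_add (A : Matrix (Fin n) (Fin n) ℕ) (γ δ : Fin n → ℕ) :
    gamRow A (γ + δ) = gamRow A γ + gamRow A δ := by
  rw [gamRow, gamRow, gamRow, ← Matrix.add_vecMul]
  congr 1
  funext i
  simp

lemma gamRow_smul (A : Matrix (Fin n) (Fin n) ℕ) (q : ℕ) (γ : Fin n → ℕ) :
    gamRow A (q • γ) = (q : ℚ) • gamRow A γ := by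
  rw [gamRow, gamRow, ← Matrix.smul_vecMul]
  congr 1
  funext i
  simp

lemma gamRow_zero (A : Matrix (Fin n) (Fin n) ℕ) : gamRow A 0 = 0 := by
  have := gamRow_smul A 0 0
  simpa using this

lemma det_Aq_transpose_ne_zero (hA : (Aq A).det ≠ 0) : (Aq Aᵀ).det ≠ 0 := by
  change (Aq A)ᵀ.det ≠ 0
  rwa [Matrix.det_transpose]

lemma gamRow_vecMul (hA : (Aq A).det ≠ 0) (k : Fin n → ℕ) :
    gamRow A (Matrix.vecMul k A) = fun i => (k i : ℚ) := by
  have h : (fun i => ((Matrix.vecMul k A i : ℕ) : ℚ)) = Matrix.vecMul (fun i => (k i : ℚ)) (Aq A) := by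
    funext i
    simp [Matrix.vecMul, dotProduct, Aq]
  rw [gamRow, h, Matrix.vecMul_vecMul, Matrix.mul_nonsing_inv _ (isUnit_iff_ne_zero.2 hA),
    Matrix.vecMul_one]

lemma gamRow_row (hA : (Aq A).det ≠ 0) (s i : Fin n) :
    gamRow A (A s) i = if s = i then 1 else 0 := by
  have h : A s = Matrix.vecMul (Pi.single s 1) A := by simp [Matrix.row]
  rw [h, gamRow_vecMul hA]
  simp [Pi.single_apply, eq_comm]

lemma vecMul_gamRow (hA : (Aq A).det ≠ 0) (γ : Fin n → ℕ) (i : Fin n) :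
    ∑ s, (A s i : ℚ) * gamRow A γ s = γ i := by
  have h : Matrix.vecMul (gamRow A γ) (Aq A) = fun i => (γ i : ℚ) := by
    rw [gamRow, Matrix.vecMul_vecMul, Matrix.nonsing_inv_mul _ (isUnit_iff_ne_zero.2 hA),
      Matrix.vecMul_one]
  have := congr_fun h i
  rw [← this]
  simp [Matrix.vecMul, dotProduct, Aq, mul_comm]

lemma gamRow_dotProduct (A : Matrix (Fin n) (Fin n) ℕ) (γ lam : Fin n → ℕ) :
    (gamRow A γ ⬝ᵥ fun i => (lam i : ℚ)) = ∑ i, (γ i : ℚ) * lamRow A lam i := by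
  rw [gamRow, lamRow, ← Matrix.dotProduct_mulVec, ← Matrix.transpose_nonsing_inv,
    Matrix.vecMul_transpose]
  rfl

lemma OKA_iff (A : Matrix (Fin n) (Fin n) ℕ) (m : MonIdx (Fin n)) :
    OKA A m ↔ (∀ i, 0 ≤ lamRow A m.2 i) ∧ ∀ i, m.1 i = 0 ∨ lamRow A m.2 i = 0 := by
  rw [OKA, gamRow_dotProduct]
  refine and_congr_right fun h => ?_
  rw [Finset.sum_eq_zero_iff_of_nonneg fun i _ => mul_nonneg (Nat.cast_nonneg _) (h i)]
  simp

lemma OKA_transpose_swap_iff (A : Matrix (Fin n) (Fin n) ℕ) (m : MonIdx (Fin n)) :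
    OKA Aᵀ m.swap ↔ (∀ i, 0 ≤ gamRow A m.1 i) ∧
      (gamRow A m.1 ⬝ᵥ fun i => (m.2 i : ℚ)) = 0 := by
  have h : lamRow Aᵀ m.1 = gamRow A m.1 := by
    rw [lamRow_eq_gamRow_transpose, Matrix.transpose_transpose]
  rw [OKA, gamRow_dotProduct, Prod.fst_swap, Prod.snd_swap, h, dotProduct_comm]
  rfl

lemma OKA_smul_monomial (A : Matrix (Fin n) (Fin n) ℕ) {q : ℕ} (hq : q ≠ 0) (γ lam : Fin n → ℕ) :
    OKA A (q • γ, q • lam) ↔ OKA A (γ, lam) := by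
  have hq' : (0 : ℚ) < q := by exact_mod_cast Nat.pos_of_ne_zero hq
  simp only [OKA_iff, lamRow_eq_gamRow_transpose, gamRow_smul, Pi.smul_apply, smul_eq_mul,
    mul_eq_zero, hq, hq'.ne', false_or, mul_nonneg_iff_of_pos_left hq']

lemma lamRow_smul_matrix (A : Matrix (Fin n) (Fin n) ℕ) {q : ℕ} (hq : q ≠ 0) (lam : Fin n → ℕ) :
    lamRow (q • A) lam = (q : ℚ)⁻¹ • lamRow A lam := by
  have hq' : (q : ℚ) ≠ 0 := by exact_mod_cast hq
  have h : (Aq (q • A))ᵀ = (q : ℚ) • (Aq A)ᵀ := by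
    ext i j
    simp only [Aq, Matrix.transpose_apply, Matrix.map_apply, Matrix.smul_apply, smul_eq_mul]
    push_cast
    rfl
  rw [lamRow, lamRow, h, ← Matrix.vecMul_smul]
  congr 1
  by_cases hA : IsUnit (Aq A)ᵀ.det
  · exact Matrix.inv_smul' _ (Units.mk0 (q : ℚ) hq') hA
  · rw [Matrix.nonsing_inv_apply_not_isUnit _ hA, Matrix.nonsing_inv_apply_not_isUnit, smul_zero]
    rw [Matrix.det_smul]
    simpa [hq', isUnit_iff_ne_zero] using hA

lemma OKA_smul_matrix (A : Matrix (Fin n) (Fin n) ℕ) {q : ℕ} (hq : q ≠ 0) (m : MonIdx (Fin n)) :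
    OKA (q • A) m ↔ OKA A m := by
  have hq' : (0 : ℚ) < (q : ℚ)⁻¹ := inv_pos.2 (by exact_mod_cast Nat.pos_of_ne_zero hq)
  simp only [OKA_iff, lamRow_smul_matrix A hq, Pi.smul_apply, smul_eq_mul,
    mul_eq_zero, hq'.ne', false_or, mul_nonneg_iff_of_pos_left hq']

end Coordinates

/-! ### The coefficients of the Dwork series `Z_A` -/

section ZCoefficients

variable {n : ℕ} {A : Matrix (Fin n) (Fin n) ℕ}

lemma vecMul_natCast_injective (hA : (Aq A).det ≠ 0) {k l : Fin n → ℕ}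
    (h : Matrix.vecMul k A = Matrix.vecMul l A) : k = l := by
  have := congr_arg (gamRow A) h
  rw [gamRow_vecMul hA, gamRow_vecMul hA] at this
  funext i
  exact_mod_cast congr_fun this i

lemma le_sum_vecMul (hA : (Aq A).det ≠ 0) (k : Fin n → ℕ) (i : Fin n) :
    k i ≤ ∑ j, Matrix.vecMul k A j := by
  have hrow : ∃ j, A i j ≠ 0 := by
    by_contra! h
    exact hA (Matrix.det_eq_zero_of_row_eq_zero i fun j => by simp [Aq, h j])
  obtain ⟨j, hj⟩ := hrow
  calc k i ≤ k i * A i j := Nat.le_mul_of_pos_right _ (Nat.pos_of_ne_zero hj)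
    _ ≤ ∑ i, k i * A i j :=
        Finset.single_le_sum (f := fun i => k i * A i j) (fun _ _ => Nat.zero_le _)
          (Finset.mem_univ i)
    _ = Matrix.vecMul k A j := rfl
    _ ≤ _ := Finset.single_le_sum (f := fun j => Matrix.vecMul k A j) (fun _ _ => Nat.zero_le _)
          (Finset.mem_univ j)

variable {K : Type} [Field K]

lemma Zcoef_vecMul (hA : (Aq A).det ≠ 0) (p : ℕ) (π : K) (k : Fin n → ℕ) :
    Zcoef K p π A (Matrix.vecMul k A) = ∏ i, dworkCoef K p π (k i) := by
  rw [Zcoef, Finset.sum_eq_single k]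
  · exact if_pos fun j => rfl
  · intro l _ hl
    exact if_neg fun h => hl (vecMul_natCast_injective hA (funext h))
  · intro h
    refine absurd (Fintype.mem_piFinset.2 fun i => ?_) h
    exact Finset.mem_range.2 (Nat.lt_succ_of_le (le_sum_vecMul hA k i))

lemma Zcoef_eq_zero (p : ℕ) (π : K) {δ : Fin n → ℕ} (h : ∀ k, Matrix.vecMul k A ≠ δ) :
    Zcoef K p π A δ = 0 :=
  Finset.sum_eq_zero fun k _ => if_neg fun hk => h k (funext hk)

lemma exists_vecMul_of_Zcoef_ne_zero {p : ℕ} {π : K} {δ : Fin n → ℕ}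
    (h : Zcoef K p π A δ ≠ 0) : ∃ k, Matrix.vecMul k A = δ := by
  by_contra! h'
  exact h (Zcoef_eq_zero p π h')

lemma gamRow_nonneg_of_Zcoef_ne_zero (hA : (Aq A).det ≠ 0) {p : ℕ} {π : K} {δ : Fin n → ℕ}
    (h : Zcoef K p π A δ ≠ 0) (i : Fin n) : 0 ≤ gamRow A δ i := by
  obtain ⟨k, rfl⟩ := exists_vecMul_of_Zcoef_ne_zero h
  rw [gamRow_vecMul hA]
  exact Nat.cast_nonneg _

lemma vecMul_add_single (k : Fin n → ℕ) (q : ℕ) (s : Fin n) :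
    Matrix.vecMul (k + Pi.single s q) A = Matrix.vecMul k A + q • A s := by
  rw [Matrix.add_vecMul]
  congr 1
  funext j
  simp [Matrix.row]

lemma Zcoef_sub_smul_row (hA : (Aq A).det ≠ 0) (p : ℕ) (π : K) (k : Fin n → ℕ) (s : Fin n) (q : ℕ) :
    (if q • A s ≤ Matrix.vecMul k A then Zcoef K p π A (Matrix.vecMul k A - q • A s) else 0)
      = if q ≤ k s then
          dworkCoef K p π (k s - q) * ∏ i ∈ Finset.univ.erase s, dworkCoef K p π (k i)
        else 0 := by
  by_cases h : q ≤ k s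
  · have hk : k = Function.update k s (k s - q) + Pi.single s q := by
      funext i
      rcases eq_or_ne i s with rfl | hi
      · simp [h]
      · simp [hi]
    have hv : Matrix.vecMul k A = Matrix.vecMul (Function.update k s (k s - q)) A + q • A s := by
      conv_lhs => rw [hk]
      rw [vecMul_add_single]
    rw [if_pos h, hv, if_pos (by simp), add_tsub_cancel_right, Zcoef_vecMul hA,
      ← Finset.mul_prod_erase _ _ (Finset.mem_univ s), Function.update_self]
    congr 1
    refine Finset.prod_congr rfl fun i hi => ?_
    rw [Function.update_of_ne (Finset.ne_of_mem_erase hi)]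
  · rw [if_neg h]
    split_ifs with h1
    · refine Zcoef_eq_zero p π fun l hl => h ?_
      have : Matrix.vecMul (l + Pi.single s q) A = Matrix.vecMul k A := by
        rw [vecMul_add_single, hl, tsub_add_cancel_of_le h1]
      rw [← vecMul_natCast_injective hA this]
      simp
    · rfl

/-- The logarithmic derivative of `Z_A`, coefficientwise. -/
lemma gamRow_mul_Zcoef [CharZero K] (hA : (Aq A).det ≠ 0) {p : ℕ} (hp : 0 < p) (π : K)
    (δ : Fin n → ℕ) (s : Fin n) :
    ((gamRow A δ s : ℚ) : K) * Zcoef K p π A δ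
      = -π * (if A s ≤ δ then Zcoef K p π A (δ - A s) else 0)
        + π * p * (if p • A s ≤ δ then Zcoef K p π A (δ - p • A s) else 0) := by
  by_cases hδ : ∃ k, Matrix.vecMul k A = δ
  · obtain ⟨k, rfl⟩ := hδ
    have h1 := Zcoef_sub_smul_row hA p π k s 1
    rw [one_smul] at h1
    rw [h1, Zcoef_sub_smul_row hA p π k s p, gamRow_vecMul hA, Zcoef_vecMul hA,
      ← Finset.mul_prod_erase _ _ (Finset.mem_univ s), Rat.cast_natCast]
    obtain hk | ⟨j, hj⟩ : k s = 0 ∨ ∃ j, k s = j + 1 := by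
      cases k s <;> simp
    · simp [hk, hp.ne']
    · rw [hj, ← mul_assoc, dworkCoef_succ K hp π j, if_pos (Nat.le_add_left 1 j),
        Nat.add_sub_cancel]
      split_ifs <;> ring
  · push Not at hδ
    have h1 := Zcoef_eq_zero p π hδ
    have h2 : ∀ q : ℕ, (if q • A s ≤ δ then Zcoef K p π A (δ - q • A s) else 0) = 0 := by
      intro q
      split_ifs with h
      · refine Zcoef_eq_zero p π fun l hl => hδ (l + Pi.single s q) ?_
        rw [vecMul_add_single, hl, tsub_add_cancel_of_le h]
      · rfl
    have h3 := h2 1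
    rw [one_smul] at h3
    rw [h1, h2, h3]
    simp

end ZCoefficients

/-! ### Power series in the variables `x, y` -/

section Series

variable {n : ℕ}

/-- The pair of exponents `(γ, λ)` as a multi-index for power series in `x, y`. -/
noncomputable def ofMon (m : MonIdx (Fin n)) : Fin n ⊕ Fin n →₀ ℕ :=
  Finsupp.equivFunOnFinite.symm (Sum.elim m.1 m.2)

/-- The pair of exponents `(γ, λ)` of a multi-index. -/
def toMon (m : Fin n ⊕ Fin n →₀ ℕ) : MonIdx (Fin n) :=
  (fun i => m (Sum.inl i), fun i => m (Sum.inr i))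

@[simp] lemma ofMon_inl (m : MonIdx (Fin n)) (i : Fin n) : ofMon m (Sum.inl i) = m.1 i := rfl

@[simp] lemma ofMon_inr (m : MonIdx (Fin n)) (i : Fin n) : ofMon m (Sum.inr i) = m.2 i := rfl

@[simp] lemma ofMon_toMon (m : Fin n ⊕ Fin n →₀ ℕ) : ofMon (toMon m) = m := by
  ext (i | i) <;> rfl

lemma ofMon_le_iff (a : MonIdx (Fin n)) (m : Fin n ⊕ Fin n →₀ ℕ) :
    ofMon a ≤ m ↔ a.1 ≤ (toMon m).1 ∧ a.2 ≤ (toMon m).2 := by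
  rw [Finsupp.le_def, Sum.forall]
  rfl

/-- The coordinates of `(γ, λ)`, namely `γ A⁻¹` followed by `λ A⁻ᵀ`. -/
noncomputable def monCoord (A : Matrix (Fin n) (Fin n) ℕ) (s : Fin n ⊕ Fin n)
    (m : Fin n ⊕ Fin n →₀ ℕ) : ℚ :=
  Sum.elim (gamRow A (toMon m).1) (lamRow A (toMon m).2) s

/-- The exponents of the monomials `x^{e_jA}` and `y^{e_jAᵀ}`. -/
noncomputable def rowMon (A : Matrix (Fin n) (Fin n) ℕ) (s : Fin n ⊕ Fin n) :
    Fin n ⊕ Fin n →₀ ℕ :=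
  ofMon (Sum.elim (fun j => (A j, 0)) (fun j => (0, Aᵀ j)) s)

variable {A : Matrix (Fin n) (Fin n) ℕ}

lemma monCoord_add (s : Fin n ⊕ Fin n) (a b : Fin n ⊕ Fin n →₀ ℕ) :
    monCoord A s (a + b) = monCoord A s a + monCoord A s b := by
  rcases s with s | s
  · exact congr_fun (gamRow_add A _ _) s
  · exact congr_fun (gamRow_add Aᵀ _ _) s

lemma monCoord_smul (s : Fin n ⊕ Fin n) (q : ℕ) (a : Fin n ⊕ Fin n →₀ ℕ) :
    monCoord A s (q • a) = q * monCoord A s a := by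
  rcases s with s | s
  · exact congr_fun (gamRow_smul A _ _) s
  · exact congr_fun (gamRow_smul Aᵀ _ _) s

lemma monCoord_rowMon (hA : (Aq A).det ≠ 0) (s t : Fin n ⊕ Fin n) :
    monCoord A t (rowMon A s) = if s = t then 1 else 0 := by
  rcases s with s | s <;> rcases t with t | t
  · exact (gamRow_row hA s t).trans (by simp only [Sum.inl.injEq])
  · exact (congr_fun (gamRow_zero Aᵀ) t).trans (by simp)
  · exact (congr_fun (gamRow_zero A) t).trans (by simp)
  · exact (gamRow_row (det_Aq_transpose_ne_zero hA) s t).trans (by simp only [Sum.inr.injEq])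

lemma OKA_toMon_iff (m : Fin n ⊕ Fin n →₀ ℕ) : OKA A (toMon m) ↔
    (∀ i, 0 ≤ monCoord A (Sum.inr i) m) ∧
      ∀ i, m (Sum.inl i) = 0 ∨ monCoord A (Sum.inr i) m = 0 :=
  OKA_iff A _

variable {K : Type} [Field K]

/-- Formal power series in `x, y`. -/
abbrev XYSeries (K : Type) [Field K] (n : ℕ) : Type := MvPowerSeries (Fin n ⊕ Fin n) K

/-- The coefficient function of a power series with prescribed coefficients. -/
def mkSeries (f : (Fin n ⊕ Fin n →₀ ℕ) → K) : XYSeries K n := f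

@[simp] lemma coeff_mkSeries (f : (Fin n ⊕ Fin n →₀ ℕ) → K) (m : Fin n ⊕ Fin n →₀ ℕ) :
    MvPowerSeries.coeff m (mkSeries f) = f m := rfl

/-- The series `∑ c_{γ,λ} x^γ y^λ`. -/
noncomputable def toSeries (A : Matrix (Fin n) (Fin n) ℕ) (c : RFull K A) : XYSeries K n :=
  mkSeries fun m => if h : OKA A (toMon m) then c ⟨toMon m, h⟩ else 0

lemma coeff_toSeries_ofMon (c : RFull K A) (m : MonIdx (Fin n)) :
    MvPowerSeries.coeff (ofMon m) (toSeries A c) = if h : OKA A m then c ⟨m, h⟩ else 0 := rfl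

lemma coeff_toSeries_coe (c : RFull K A) (m : AMon A) :
    MvPowerSeries.coeff (ofMon m.1) (toSeries A c) = c m := by
  rw [coeff_toSeries_ofMon, dif_pos m.2]

lemma toSeries_injective : Function.Injective (toSeries (K := K) A) := by
  intro c c' h
  funext m
  rw [← coeff_toSeries_coe c, h, coeff_toSeries_coe]

/-- Set the monomials which are not allowed in `R_A` to zero. -/
noncomputable def projOK (A : Matrix (Fin n) (Fin n) ℕ) : XYSeries K n →ₗ[K] XYSeries K n where
  toFun f := mkSeries fun m => if OKA A (toMon m) then MvPowerSeries.coeff m f else 0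
  map_add' f g := by
    ext m
    by_cases h : OKA A (toMon m) <;> simp [h]
  map_smul' a f := by
    ext m
    by_cases h : OKA A (toMon m) <;> simp [h]

lemma coeff_projOK (f : XYSeries K n) (m : Fin n ⊕ Fin n →₀ ℕ) :
    MvPowerSeries.coeff m (projOK A f)
      = if OKA A (toMon m) then MvPowerSeries.coeff m f else 0 := rfl

lemma projOK_toSeries (c : RFull K A) : projOK A (toSeries A c) = toSeries A c := by
  ext m
  rw [coeff_projOK]
  split_ifs with h
  · rfl
  · simp [toSeries, h]

lemma toSeries_eq_projOK {c : RFull K A} {f : XYSeries K n}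
    (h : ∀ m : AMon A, c m = MvPowerSeries.coeff (ofMon m.1) f) :
    toSeries A c = projOK A f := by
  ext m
  rw [coeff_projOK, toSeries, coeff_mkSeries]
  split_ifs with hm
  · rw [h, ofMon_toMon]
  · rfl

/-- The coordinates `λ A⁻ᵀ` of all monomials occurring in `f` are nonnegative. -/
def LamNonneg (A : Matrix (Fin n) (Fin n) ℕ) (f : XYSeries K n) : Prop :=
  ∀ m, MvPowerSeries.coeff m f ≠ 0 → ∀ i, 0 ≤ monCoord A (Sum.inr i) m

lemma lamNonneg_projOK (f : XYSeries K n) : LamNonneg A (projOK A f) := by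
  intro m hm
  rw [coeff_projOK] at hm
  split_ifs at hm with h
  · exact ((OKA_toMon_iff m).1 h).1
  · exact absurd rfl hm

lemma lamNonneg_toSeries (c : RFull K A) : LamNonneg A (toSeries A c) := by
  rw [← projOK_toSeries]; exact lamNonneg_projOK _

lemma LamNonneg.mul {f g : XYSeries K n} (hf : LamNonneg A f) (hg : LamNonneg A g) :
    LamNonneg A (f * g) := by
  intro m hm i
  rw [MvPowerSeries.coeff_mul] at hm
  obtain ⟨⟨a, b⟩, hab, h⟩ := Finset.exists_ne_zero_of_sum_ne_zero hm
  rw [← Finset.HasAntidiagonal.mem_antidiagonal.1 hab, monCoord_add]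
  exact add_nonneg (hf a (left_ne_zero_of_mul h) i) (hg b (right_ne_zero_of_mul h) i)

lemma lamNonneg_monomial_rowMon (hA : (Aq A).det ≠ 0) (s : Fin n ⊕ Fin n) (a : K) :
    LamNonneg A (MvPowerSeries.monomial (rowMon A s) a) := by
  intro m hm i
  rw [MvPowerSeries.coeff_monomial] at hm
  split_ifs at hm with h
  · rw [h, monCoord_rowMon hA]
    split_ifs <;> simp
  · exact absurd rfl hm

lemma projOK_mul_projOK {f g : XYSeries K n} (hf : LamNonneg A f) (hg : LamNonneg A g) :
    projOK A (f * projOK A g) = projOK A (f * g) := by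
  ext m
  rw [coeff_projOK, coeff_projOK]
  split_ifs with hm
  · rw [MvPowerSeries.coeff_mul, MvPowerSeries.coeff_mul]
    refine Finset.sum_congr rfl fun ab hab => ?_
    obtain ⟨a, b⟩ := ab
    have hab := Finset.HasAntidiagonal.mem_antidiagonal.1 hab
    dsimp only at hab ⊢
    by_cases ha : MvPowerSeries.coeff a f = 0
    · rw [ha, zero_mul, zero_mul]
    by_cases hb : MvPowerSeries.coeff b g = 0
    · rw [coeff_projOK, hb, ite_self]
    rw [coeff_projOK, if_pos]
    refine (OKA_toMon_iff b).2 ⟨hg b hb, fun i => ?_⟩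
    rw [OKA_toMon_iff, ← hab] at hm
    rcases hm.2 i with h | h
    · left
      rw [Finsupp.add_apply] at h
      omega
    · right
      rw [monCoord_add] at h
      have h1 := hf a ha i
      have h2 := hg b hb i
      linarith
  · rfl

/-- The derivation of power series multiplying each monomial with its coordinate. -/
noncomputable def coordDer (A : Matrix (Fin n) (Fin n) ℕ) (s : Fin n ⊕ Fin n) :
    XYSeries K n →ₗ[K] XYSeries K n where
  toFun f := mkSeries fun m => (monCoord A s m : K) * MvPowerSeries.coeff m f
  map_add' f g := by
    ext m
    simp [mul_add]
  map_smul' a f := by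
    ext m
    simp [mul_left_comm]

lemma coeff_coordDer (s : Fin n ⊕ Fin n) (f : XYSeries K n) (m : Fin n ⊕ Fin n →₀ ℕ) :
    MvPowerSeries.coeff m (coordDer A s f) = (monCoord A s m : K) * MvPowerSeries.coeff m f := rfl

lemma coordDer_projOK (s : Fin n ⊕ Fin n) (f : XYSeries K n) :
    coordDer A s (projOK A f) = projOK A (coordDer A s f) := by
  ext m
  rw [coeff_coordDer, coeff_projOK, coeff_projOK, coeff_coordDer]
  split_ifs <;> simp

lemma LamNonneg.coordDer {f : XYSeries K n} (hf : LamNonneg A f) (s : Fin n ⊕ Fin n) :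
    LamNonneg A (coordDer A s f) := by
  intro m hm
  rw [coeff_coordDer] at hm
  exact hf m (right_ne_zero_of_mul hm)

lemma coordDer_mul [CharZero K] (s : Fin n ⊕ Fin n) (f g : XYSeries K n) :
    coordDer A s (f * g) = coordDer A s f * g + f * coordDer A s g := by
  ext m
  rw [map_add, coeff_coordDer, MvPowerSeries.coeff_mul, MvPowerSeries.coeff_mul,
    MvPowerSeries.coeff_mul, Finset.mul_sum, ← Finset.sum_add_distrib]
  refine Finset.sum_congr rfl fun ab hab => ?_
  rw [← Finset.HasAntidiagonal.mem_antidiagonal.1 hab, monCoord_add, coeff_coordDer, coeff_coordDer]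
  push_cast
  ring

lemma eq_smul_of_forall_dvd {p : ℕ} {m : Fin n ⊕ Fin n →₀ ℕ} (h : ∀ i, p ∣ m i) :
    ∃ l : Fin n ⊕ Fin n →₀ ℕ, m = p • l := by
  choose l hl using h
  exact ⟨Finsupp.equivFunOnFinite.symm l, by ext i; simp [hl i]⟩

lemma OKA_toMon_smul {p : ℕ} (hp : p ≠ 0) (l : Fin n ⊕ Fin n →₀ ℕ) :
    OKA A (toMon (p • l)) ↔ OKA A (toMon l) :=
  OKA_smul_monomial A hp _ _

lemma coeff_expand_eq_zero {p : ℕ} (hp : p ≠ 0) {m : Fin n ⊕ Fin n →₀ ℕ} (h : ¬ ∀ i, p ∣ m i)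
    (f : XYSeries K n) : MvPowerSeries.coeff m (MvPowerSeries.expand p hp f) = 0 := by
  push Not at h
  obtain ⟨i, hi⟩ := h
  exact MvPowerSeries.coeff_expand_of_not_dvd p hp f hi

lemma expand_projOK {p : ℕ} (hp : p ≠ 0) (f : XYSeries K n) :
    MvPowerSeries.expand p hp (projOK A f) = projOK A (MvPowerSeries.expand p hp f) := by
  ext m
  rw [coeff_projOK]
  by_cases h : ∀ i, p ∣ m i
  · obtain ⟨l, rfl⟩ := eq_smul_of_forall_dvd h
    rw [MvPowerSeries.coeff_expand_smul, MvPowerSeries.coeff_expand_smul, coeff_projOK]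
    simp only [OKA_toMon_smul hp]
  · rw [coeff_expand_eq_zero hp h, coeff_expand_eq_zero hp h, ite_self]

lemma coordDer_expand [CharZero K] {p : ℕ} (hp : p ≠ 0) (s : Fin n ⊕ Fin n) (f : XYSeries K n) :
    coordDer A s (MvPowerSeries.expand p hp f)
      = (p : K) • MvPowerSeries.expand p hp (coordDer A s f) := by
  ext m
  rw [coeff_coordDer, map_smul, smul_eq_mul]
  by_cases h : ∀ i, p ∣ m i
  · obtain ⟨l, rfl⟩ := eq_smul_of_forall_dvd h
    rw [MvPowerSeries.coeff_expand_smul, MvPowerSeries.coeff_expand_smul, coeff_coordDer,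
      monCoord_smul]
    push_cast
    ring
  · rw [coeff_expand_eq_zero hp h, coeff_expand_eq_zero hp h, mul_zero, mul_zero]

lemma LamNonneg.expand {p : ℕ} (hp : p ≠ 0) {f : XYSeries K n} (hf : LamNonneg A f) :
    LamNonneg A (MvPowerSeries.expand p hp f) := by
  intro m hm i
  by_cases h : ∀ i, p ∣ m i
  · obtain ⟨l, rfl⟩ := eq_smul_of_forall_dvd h
    rw [MvPowerSeries.coeff_expand_smul] at hm
    rw [monCoord_smul]
    exact mul_nonneg (Nat.cast_nonneg _) (hf l hm i)
  · exact absurd (coeff_expand_eq_zero hp h f) hm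

/-! ### Multiplication by the Dwork series -/

/-- The series `Z_A(x) Z_{Aᵀ}(y)`. -/
noncomputable def zSeries (p : ℕ) (π : K) (A : Matrix (Fin n) (Fin n) ℕ) : XYSeries K n :=
  mkSeries fun m => Zcoef K p π A (toMon m).1 * Zcoef K p π Aᵀ (toMon m).2

lemma coeff_zSeries (p : ℕ) (π : K) (m : Fin n ⊕ Fin n →₀ ℕ) :
    MvPowerSeries.coeff m (zSeries p π A)
      = Zcoef K p π A (toMon m).1 * Zcoef K p π Aᵀ (toMon m).2 := rfl

lemma lamNonneg_zSeries (hA : (Aq A).det ≠ 0) (p : ℕ) (π : K) : LamNonneg A (zSeries p π A) :=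
  fun _ hm i => gamRow_nonneg_of_Zcoef_ne_zero (det_Aq_transpose_ne_zero hA)
    (right_ne_zero_of_mul hm) i

lemma coordDer_zSeries [CharZero K] (hA : (Aq A).det ≠ 0) {p : ℕ} (hp : 0 < p) (π : K)
    (s : Fin n ⊕ Fin n) :
    coordDer A s (zSeries p π A)
      = -(π • (MvPowerSeries.monomial (rowMon A s) 1 * zSeries p π A))
        + (p : K) • (π • (MvPowerSeries.monomial (p • rowMon A s) 1 * zSeries p π A)) := by
  ext m
  simp only [map_add, map_neg, map_smul, smul_eq_mul, MvPowerSeries.coeff_monomial_mul,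
    coeff_coordDer, coeff_zSeries, one_mul]
  rcases s with s | s
  · have h := gamRow_mul_Zcoef hA hp π (toMon m).1 s
    have hle : ∀ q : ℕ, q • rowMon A (Sum.inl s) ≤ m ↔ q • A s ≤ (toMon m).1 := by
      intro q
      have : q • rowMon A (Sum.inl s) = ofMon (q • A s, 0) := by
        ext (i | i) <;> simp [rowMon]
      rw [this, ofMon_le_iff]
      exact and_iff_left fun i => Nat.zero_le _
    have hsub : ∀ q : ℕ, toMon (m - q • rowMon A (Sum.inl s))
        = ((toMon m).1 - q • A s, (toMon m).2) := by
      intro q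
      refine Prod.ext rfl ?_
      funext i
      simp [toMon, rowMon]
    have hle1 := hle 1
    have hsub1 := hsub 1
    rw [one_smul, one_smul] at hle1 hsub1
    simp only [hle, hsub, hle1, hsub1]
    change ((gamRow A (toMon m).1 s : ℚ) : K) * _ = _
    rw [← mul_assoc, h]
    split_ifs <;> ring
  · have h := gamRow_mul_Zcoef (det_Aq_transpose_ne_zero hA) hp π (toMon m).2 s
    have hle : ∀ q : ℕ, q • rowMon A (Sum.inr s) ≤ m ↔ q • Aᵀ s ≤ (toMon m).2 := by
      intro q
      have : q • rowMon A (Sum.inr s) = ofMon (0, q • Aᵀ s) := by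
        ext (i | i) <;> simp [rowMon]
      rw [this, ofMon_le_iff]
      exact and_iff_right fun i => Nat.zero_le _
    have hsub : ∀ q : ℕ, toMon (m - q • rowMon A (Sum.inr s))
        = ((toMon m).1, (toMon m).2 - q • Aᵀ s) := by
      intro q
      refine Prod.ext ?_ rfl
      funext i
      simp [toMon, rowMon]
    have hle1 := hle 1
    have hsub1 := hsub 1
    rw [one_smul, one_smul] at hle1 hsub1
    simp only [hle, hsub, hle1, hsub1]
    change ((gamRow Aᵀ (toMon m).2 s : ℚ) : K) * _ = _
    rw [mul_left_comm, h]
    split_ifs <;> ring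

/-- The twisted derivation `f ↦ θ f + π x^a f`, truncated to `R_A`. -/
noncomputable def twistDer (π : K) (A : Matrix (Fin n) (Fin n) ℕ) (s : Fin n ⊕ Fin n)
    (f : XYSeries K n) : XYSeries K n :=
  projOK A (coordDer A s f + π • (MvPowerSeries.monomial (rowMon A s) 1 * f))

/-- Frobenius `f ↦ Z f(x^p, y^p)`, truncated to `R_A`. -/
noncomputable def frobSeries {p : ℕ} (hp : p ≠ 0) (π : K) (A : Matrix (Fin n) (Fin n) ℕ)
    (f : XYSeries K n) : XYSeries K n :=
  projOK A (zSeries p π A * MvPowerSeries.expand p hp f)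

lemma twistDer_frobSeries [CharZero K] (hA : (Aq A).det ≠ 0) {p : ℕ} (hp : p ≠ 0) (π : K)
    (s : Fin n ⊕ Fin n) {f : XYSeries K n} (hf : LamNonneg A f) :
    twistDer π A s (frobSeries hp π A f) = (p : K) • frobSeries hp π A (twistDer π A s f) := by
  have hZ := lamNonneg_zSeries hA p π
  have hE := hf.expand hp
  rw [twistDer, frobSeries, frobSeries, twistDer, map_add, map_smul,
    projOK_mul_projOK (lamNonneg_monomial_rowMon hA s 1) (hZ.mul hE), coordDer_projOK,
    expand_projOK, projOK_mul_projOK hZ, ← map_smul, ← map_smul (projOK A)]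
  · have hid : projOK A (projOK A (coordDer A s (zSeries p π A * MvPowerSeries.expand p hp f)))
        = projOK A (coordDer A s (zSeries p π A * MvPowerSeries.expand p hp f)) := by
      ext m
      simp only [coeff_projOK]
      split_ifs <;> rfl
    rw [hid, ← map_add]
    congr 1
    rw [coordDer_mul, coordDer_zSeries hA (Nat.pos_of_ne_zero hp), coordDer_expand, map_add,
      map_smul, map_mul, MvPowerSeries.expand_monomial]
    simp only [MvPowerSeries.smul_eq_C_mul]
    ring
  · refine LamNonneg.expand hp ?_
    intro m hm i
    rw [map_add] at hm
    by_contra h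
    have h1 : MvPowerSeries.coeff m (coordDer A s f) = 0 := by
      by_contra h1
      exact h (hf.coordDer s m h1 i)
    have h2 : MvPowerSeries.coeff m (π • (MvPowerSeries.monomial (rowMon A s) 1 * f)) = 0 := by
      rw [map_smul]
      by_contra h2
      exact h (((lamNonneg_monomial_rowMon hA s 1).mul hf) m (right_ne_zero_of_mul h2) i)
    exact hm (by rw [h1, h2, add_zero])

end Series

/-! ### The Frobenius is a chain map -/

section ChainMap

variable {n : ℕ} {A : Matrix (Fin n) (Fin n) ℕ} {K : Type} [Field K]

lemma getD_map_dite {α : Type} {P : Prop} {d d' : Decidable P} (f : P → α) (c : α → K) :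
    ((@dite _ P d (fun h => some (f h)) fun _ => none).map c).getD 0
      = @dite _ P d' (fun h => c (f h)) fun _ => 0 := by
  split_ifs <;> rfl

lemma tmap_apply {α β : Type} (T : (α → K) →ₗ[K] (β → K))
    (L : ExtV K (Fin n) →ₗ[K] ExtV K (Fin n)) (c : α × Finset (Fin n) → K)
    (b : β) (S : Finset (Fin n)) :
    tmap T L c (b, S) = L (fun S' => T (fun m => c (m, S')) b) S := by
  set v : ExtV K (Fin n) := fun S' => T (fun m => c (m, S')) b with hv
  have h : v = ∑ S', v S' • (Pi.single S' 1 : ExtV K (Fin n)) := by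
    funext S'
    simp [Finset.sum_apply, Pi.single_apply]
  change ∑ S' : Finset (Fin n), L (Pi.single S' 1) S * v S' = L v S
  conv_rhs => rw [h]
  simp only [map_sum, map_smul, Finset.sum_apply, Pi.smul_apply, smul_eq_mul, mul_comm]

lemma phiF_apply (π : K) (i : Fin n) (c : RFull K A) (m : AMon A) :
    phiF K π A i c m = π * ∑ j, (A j i : K) *
      if h : (∀ k, A j k ≤ m.1.1 k) ∧ OKA A ((fun k => m.1.1 k - A j k), m.1.2)
      then c ⟨((fun k => m.1.1 k - A j k), m.1.2), h.2⟩ else 0 := by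
  simp only [phiF, LinearMap.smul_apply, LinearMap.sum_apply, Pi.smul_apply, Finset.sum_apply,
    smul_eq_mul]
  congr 1
  refine Finset.sum_congr rfl fun j _ => ?_
  congr 1
  exact getD_map_dite (K := K) (α := AMon A) (P := (∀ k, A j k ≤ m.1.1 k) ∧
    OKA A ((fun k => m.1.1 k - A j k), m.1.2)) (fun h => ⟨_, h.2⟩) c

lemma dxF_apply (π : K) (i : Fin n) (c : RFull K A) (m : AMon A) :
    dxF K π A i c m = m.1.1 i * c m + π * ∑ j, (A j i : K) *
      if h : (∀ k, A j k ≤ m.1.1 k) ∧ OKA A ((fun k => m.1.1 k - A j k), m.1.2)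
      then c ⟨((fun k => m.1.1 k - A j k), m.1.2), h.2⟩ else 0 := by
  rw [← phiF_apply]
  rfl

lemma psidualF_apply (i : Fin n) (c : RFull K A) (m : AMon A) :
    psidualF K A i c m = if h : (∀ j, A j i ≤ m.1.2 j) ∧ OKA A (m.1.1, fun j => m.1.2 j - A j i)
      then c ⟨(m.1.1, fun j => m.1.2 j - A j i), h.2⟩ else 0 :=
  getD_map_dite (K := K) (α := AMon A) (P := (∀ j, A j i ≤ m.1.2 j) ∧
    OKA A (m.1.1, fun j => m.1.2 j - A j i)) (fun h => ⟨(m.1.1, fun j => m.1.2 j - A j i), h.2⟩) c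

lemma ThetaPrimeF_apply (p : ℕ) (c : RFull K A) (m : AMon (p • A)) :
    ThetaPrimeF K p A c m = if h : OKA A ((fun i => m.1.1 i / p), (fun i => m.1.2 i / p)) ∧
        (∀ i, p ∣ m.1.1 i ∧ p ∣ m.1.2 i)
      then c ⟨((fun i => m.1.1 i / p), (fun i => m.1.2 i / p)), h.1⟩ else 0 :=
  getD_map_dite (K := K) (α := AMon A) (P := OKA A ((fun i => m.1.1 i / p), (fun i => m.1.2 i / p)) ∧
    (∀ i, p ∣ m.1.1 i ∧ p ∣ m.1.2 i))
    (fun h => ⟨((fun i => m.1.1 i / p), (fun i => m.1.2 i / p)), h.1⟩) c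

lemma dyF_apply (π : K) (i : Fin n) (c : RFull K A) (m : AMon A) :
    dyF K π A i c m = π⁻¹ * ((lamRow A m.1.2 i : ℚ) : K) * c m +
      if h : (∀ j, A j i ≤ m.1.2 j) ∧ OKA A (m.1.1, fun j => m.1.2 j - A j i)
      then c ⟨(m.1.1, fun j => m.1.2 j - A j i), h.2⟩ else 0 := by
  rw [← psidualF_apply]
  rfl

lemma dite_and_eq {P Q : Prop} {dP : Decidable P} {dQ : Decidable Q} {dPQ : Decidable (P ∧ Q)}
    (f : Q → K) :
    (@dite _ (P ∧ Q) dPQ (fun h => f h.2) fun _ => 0) = if P then (if h : Q then f h else 0) else 0 := by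
  by_cases hP : P <;> by_cases hQ : Q <;> simp [hP, hQ]

lemma coeff_monomial_mul_toSeries_inl (c : RFull K A) (m : AMon A) (j : Fin n) :
    MvPowerSeries.coeff (ofMon m.1) (MvPowerSeries.monomial (rowMon A (Sum.inl j)) 1 * toSeries A c)
      = if h : (∀ k, A j k ≤ m.1.1 k) ∧ OKA A ((fun k => m.1.1 k - A j k), m.1.2)
        then c ⟨((fun k => m.1.1 k - A j k), m.1.2), h.2⟩ else 0 := by
  have h1 : rowMon A (Sum.inl j) ≤ ofMon m.1 ↔ ∀ k, A j k ≤ m.1.1 k := by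
    rw [rowMon, ofMon_le_iff]
    exact and_iff_left fun i => Nat.zero_le _
  have h2 : ofMon m.1 - rowMon A (Sum.inl j) = ofMon ((fun k => m.1.1 k - A j k), m.1.2) := by
    ext (i | i) <;> simp [rowMon]
  rw [MvPowerSeries.coeff_monomial_mul, h2, coeff_toSeries_ofMon, one_mul]
  simp only [h1]
  exact (dite_and_eq (K := K) (Q := OKA A ((fun k => m.1.1 k - A j k), m.1.2))
    (fun h => c ⟨_, h⟩)).symm

lemma coeff_monomial_mul_toSeries_inr (c : RFull K A) (m : AMon A) (i : Fin n) :
    MvPowerSeries.coeff (ofMon m.1) (MvPowerSeries.monomial (rowMon A (Sum.inr i)) 1 * toSeries A c)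
      = if h : (∀ j, A j i ≤ m.1.2 j) ∧ OKA A (m.1.1, fun j => m.1.2 j - A j i)
        then c ⟨(m.1.1, fun j => m.1.2 j - A j i), h.2⟩ else 0 := by
  have h1 : rowMon A (Sum.inr i) ≤ ofMon m.1 ↔ ∀ j, A j i ≤ m.1.2 j := by
    rw [rowMon, ofMon_le_iff]
    exact and_iff_right fun i => Nat.zero_le _
  have h2 : ofMon m.1 - rowMon A (Sum.inr i) = ofMon (m.1.1, fun j => m.1.2 j - A j i) := by
    ext (j | j) <;> simp [rowMon]
  rw [MvPowerSeries.coeff_monomial_mul, h2, coeff_toSeries_ofMon, one_mul]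
  simp only [h1]
  exact (dite_and_eq (K := K) (Q := OKA A (m.1.1, fun j => m.1.2 j - A j i))
    (fun h => c ⟨_, h⟩)).symm

lemma toSeries_dxF [CharZero K] (hA : (Aq A).det ≠ 0) (π : K) (i : Fin n) (c : RFull K A) :
    toSeries A (dxF K π A i c)
      = ∑ s, (A s i : K) • twistDer π A (Sum.inl s) (toSeries A c) := by
  simp only [twistDer, ← map_smul, ← map_sum]
  refine toSeries_eq_projOK fun m => ?_
  simp only [map_sum, map_smul, map_add, smul_eq_mul, coeff_monomial_mul_toSeries_inl,
    coeff_coordDer, coeff_toSeries_coe, dxF_apply]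
  have h : (m.1.1 i : K) = ∑ s, (A s i : K) * (monCoord A (Sum.inl s) (ofMon m.1) : K) := by
    have := congr_arg (fun q : ℚ => (q : K)) (vecMul_gamRow hA m.1.1 i)
    simp only [Rat.cast_sum, Rat.cast_mul, Rat.cast_natCast] at this
    exact this.symm
  rw [h, Finset.sum_mul, Finset.mul_sum, ← Finset.sum_add_distrib]
  refine Finset.sum_congr rfl fun s _ => ?_
  ring

lemma toSeries_dyF {π : K} (hπ : π ≠ 0) (i : Fin n) (c : RFull K A) :
    toSeries A (dyF K π A i c) = π⁻¹ • twistDer π A (Sum.inr i) (toSeries A c) := by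
  rw [twistDer, ← map_smul]
  refine toSeries_eq_projOK fun m => ?_
  simp only [map_smul, map_add, smul_eq_mul, coeff_monomial_mul_toSeries_inr,
    coeff_coordDer, coeff_toSeries_coe, dyF_apply]
  rw [mul_add, inv_mul_cancel_left₀ hπ, ← mul_assoc]
  rfl

lemma ZmulF_apply (p : ℕ) (π : K) (c : RFull K (p • A)) (m : AMon A) :
    ZmulF K p π A c m
      = MvPowerSeries.coeff (ofMon m.1) (zSeries p π A * toSeries (p • A) c) := by
  rw [MvPowerSeries.coeff_mul]
  change ∑ δ ∈ Fintype.piFinset (fun _ : Fin n => Finset.range ((∑ j, m.1.1 j) + 1)),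
      ∑ ε ∈ Fintype.piFinset (fun _ : Fin n => Finset.range ((∑ j, m.1.2 j) + 1)), _ = _
  rw [← Finset.sum_product']
  symm
  refine Finset.sum_bij_ne_zero (fun ab _ _ => toMon ab.1) ?_ ?_ ?_ ?_
  · intro ab hab _
    have hab := Finset.HasAntidiagonal.mem_antidiagonal.1 hab
    simp only [Finset.mem_product, Fintype.mem_piFinset, Finset.mem_range, Nat.lt_succ_iff]
    refine ⟨fun i => ?_, fun i => ?_⟩
    · calc ab.1 (Sum.inl i) ≤ ofMon m.1 (Sum.inl i) := by rw [← hab]; simp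
        _ ≤ ∑ j, m.1.1 j := Finset.single_le_sum (f := m.1.1) (fun _ _ => Nat.zero_le _)
            (Finset.mem_univ i)
    · calc ab.1 (Sum.inr i) ≤ ofMon m.1 (Sum.inr i) := by rw [← hab]; simp
        _ ≤ ∑ j, m.1.2 j := Finset.single_le_sum (f := m.1.2) (fun _ _ => Nat.zero_le _)
            (Finset.mem_univ i)
  · intro ab hab _ cd hcd _ h
    have hab := Finset.HasAntidiagonal.mem_antidiagonal.1 hab
    have hcd := Finset.HasAntidiagonal.mem_antidiagonal.1 hcd
    have h1 : ab.1 = cd.1 := by rw [← ofMon_toMon ab.1, h, ofMon_toMon]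
    refine Prod.ext h1 ?_
    rw [← hab, h1] at hcd
    exact (add_left_cancel hcd).symm
  · rintro ⟨δ, ε⟩ - h
    dsimp only at h
    have hd : (∀ k, δ k ≤ m.1.1 k) ∧ (∀ k, ε k ≤ m.1.2 k) ∧
        OKA (p • A) ((fun k => m.1.1 k - δ k), (fun k => m.1.2 k - ε k)) := by
      by_contra hd
      rw [dif_neg hd, mul_zero] at h
      exact h rfl
    have hle : ofMon (δ, ε) ≤ ofMon m.1 := (ofMon_le_iff _ _).2 ⟨hd.1, hd.2.1⟩
    have hsub : ofMon m.1 - ofMon (δ, ε)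
        = ofMon ((fun k => m.1.1 k - δ k), (fun k => m.1.2 k - ε k)) := by
      ext (j | j) <;> simp
    refine ⟨(ofMon (δ, ε), ofMon m.1 - ofMon (δ, ε)),
      Finset.HasAntidiagonal.mem_antidiagonal.2 (add_tsub_cancel_of_le hle), ?_, rfl⟩
    rw [dif_pos hd] at h
    rw [hsub, coeff_toSeries_ofMon, dif_pos hd.2.2]
    exact h
  · rintro ⟨a, b⟩ hab h
    have hab := Finset.HasAntidiagonal.mem_antidiagonal.1 hab
    dsimp only at hab h ⊢
    have hb : OKA (p • A) (toMon b) := by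
      by_contra hb
      refine right_ne_zero_of_mul h ?_
      rw [toSeries, coeff_mkSeries, dif_neg hb]
    have hb' : toMon b = ((fun k => m.1.1 k - (toMon a).1 k), (fun k => m.1.2 k - (toMon a).2 k)) := by
      have h1 : ∀ s, b s = ofMon m.1 s - a s := fun s => by rw [← hab]; simp
      exact Prod.ext (funext fun k => h1 (Sum.inl k)) (funext fun k => h1 (Sum.inr k))
    have hle : ∀ s, a s ≤ ofMon m.1 s := fun s => by rw [← hab]; simp
    rw [dif_pos ⟨fun k => hle (Sum.inl k), fun k => hle (Sum.inr k), hb' ▸ hb⟩, coeff_zSeries,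
      toSeries, coeff_mkSeries, dif_pos hb]
    congr 2
    exact Subtype.ext hb'

lemma toSeries_ThetaPrimeF {p : ℕ} (hp : p ≠ 0) (c : RFull K A) :
    toSeries (p • A) (ThetaPrimeF K p A c) = MvPowerSeries.expand p hp (toSeries A c) := by
  ext m
  rw [toSeries, coeff_mkSeries]
  simp only [OKA_smul_matrix A hp]
  by_cases h : ∀ i, p ∣ m i
  · obtain ⟨l, rfl⟩ := eq_smul_of_forall_dvd h
    have hl : ((fun i => (toMon (p • l)).1 i / p), fun i => (toMon (p • l)).2 i / p) = toMon l := by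
      refine Prod.ext ?_ ?_ <;> funext i <;> simp [toMon, Nat.pos_of_ne_zero hp]
    rw [MvPowerSeries.coeff_expand_smul, toSeries, coeff_mkSeries]
    by_cases hm : OKA A (toMon l)
    · rw [dif_pos hm, dif_pos ((OKA_toMon_smul hp l).2 hm), ThetaPrimeF_apply, dif_pos]
      · congr 1
        exact Subtype.ext hl
      · exact ⟨by rw [hl]; exact hm, fun i => ⟨h _, h _⟩⟩
    · rw [dif_neg hm, dif_neg fun h' => hm ((OKA_toMon_smul hp l).1 h')]
  · rw [coeff_expand_eq_zero hp h]
    split_ifs with hm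
    · rw [ThetaPrimeF_apply, dif_neg]
      exact fun h' => h (Sum.forall.2 ⟨fun i => (h'.2 i).1, fun i => (h'.2 i).2⟩)
    · rfl

/-- The operator `Θ''_A ∘ Θ'_A`. -/
noncomputable abbrev thetaF (K : Type) [Field K] {n : ℕ} (A : Matrix (Fin n) (Fin n) ℕ) (p : ℕ)
    (π : K) : RFull K A →ₗ[K] RFull K A :=
  (ZmulF K p π A).comp (ThetaPrimeF K p A)

lemma toSeries_thetaF {p : ℕ} (hp : p ≠ 0) (π : K) (c : RFull K A) :
    toSeries A (thetaF K A p π c) = frobSeries hp π A (toSeries A c) := by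
  refine toSeries_eq_projOK fun m => ?_
  rw [← toSeries_ThetaPrimeF hp]
  exact ZmulF_apply p π _ m

lemma toSeries_smul (a : K) (c : RFull K A) : toSeries A (a • c) = a • toSeries A c := by
  ext m
  rw [map_smul, toSeries, toSeries, coeff_mkSeries, coeff_mkSeries]
  split_ifs <;> simp

lemma frobSeries_smul {p : ℕ} (hp : p ≠ 0) (π a : K) (f : XYSeries K n) :
    frobSeries hp π A (a • f) = a • frobSeries hp π A f := by
  rw [frobSeries, frobSeries, map_smul, mul_smul_comm, map_smul]

lemma frobSeries_sum {p : ℕ} (hp : p ≠ 0) (π : K) (f : Fin n → XYSeries K n) :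
    frobSeries hp π A (∑ i, f i) = ∑ i, frobSeries hp π A (f i) := by
  simp only [frobSeries, map_sum, Finset.mul_sum]

lemma dxF_thetaF [CharZero K] (hA : (Aq A).det ≠ 0) {p : ℕ} (hp : p ≠ 0) (π : K) (i : Fin n)
    (c : RFull K A) :
    dxF K π A i (thetaF K A p π c) = (p : K) • thetaF K A p π (dxF K π A i c) := by
  apply toSeries_injective
  rw [toSeries_dxF hA, toSeries_smul, toSeries_thetaF hp, toSeries_thetaF hp, toSeries_dxF hA,
    frobSeries_sum, Finset.smul_sum]
  refine Finset.sum_congr rfl fun s _ => ?_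
  rw [twistDer_frobSeries hA hp π _ (lamNonneg_toSeries c), frobSeries_smul, smul_comm]

lemma dyF_thetaF [CharZero K] (hA : (Aq A).det ≠ 0) {p : ℕ} (hp : p ≠ 0) {π : K} (hπ : π ≠ 0)
    (i : Fin n) (c : RFull K A) :
    dyF K π A i (thetaF K A p π c) = (p : K) • thetaF K A p π (dyF K π A i c) := by
  apply toSeries_injective
  rw [toSeries_dyF hπ, toSeries_smul, toSeries_thetaF hp, toSeries_thetaF hp, toSeries_dyF hπ,
    twistDer_frobSeries hA hp π _ (lamNonneg_toSeries c), frobSeries_smul, smul_comm]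

lemma qexp_erase {m m' : AMon A} {S : Finset (Fin n)} {i : Fin n} (hi : i ∈ S)
    (h0 : lamRow A m.1.2 i = 0) (hmm : m'.1.2 = m.1.2) :
    qexpQ A (m, S) + qexpDual A (m, S)
      = qexpQ A (m', S.erase i) + qexpDual A (m', S.erase i) + 1 := by
  have h : qexpDual A (m', S.erase i) = qexpDual A (m, S) := by
    rw [qexpDual, qexpDual, hmm]
    congr 1
    refine Finset.filter_congr fun j _ => ?_
    rcases eq_or_ne j i with rfl | hj
    · simp [h0]
    · simp [hj]
  have h2 := Finset.card_erase_add_one hi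
  rw [qexpQ, qexpQ, h]
  dsimp only
  omega

lemma qexp_insert {m m' : AMon A} {S : Finset (Fin n)} {i : Fin n} (hi : i ∉ S)
    (h0 : lamRow A m.1.2 i ≠ 0) (hmm : ∀ j, j ≠ i → lamRow A m'.1.2 j = lamRow A m.1.2 j) :
    qexpQ A (m, S) + qexpDual A (m, S)
      = qexpQ A (m', insert i S) + qexpDual A (m', insert i S) + 1 := by
  have h : qexpDual A (m, S) = qexpDual A (m', insert i S) + 1 := by
    rw [qexpDual, qexpDual]
    have : (Finset.univ.filter fun j => j ∉ S ∧ lamRow A m.1.2 j ≠ 0)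
        = insert i (Finset.univ.filter fun j => j ∉ insert i S ∧ lamRow A m'.1.2 j ≠ 0) := by
      ext j
      rcases eq_or_ne j i with rfl | hj
      · simp [hi, h0]
      · simp [hj, hmm j hj]
    dsimp only
    rw [this, Finset.card_insert_of_notMem (by simp)]
  have h2 := Finset.card_insert_of_notMem hi
  rw [qexpQ, qexpQ]
  dsimp only
  omega

lemma lamRow_eq_zero_of_ne_zero {m : AMon A} {i : Fin n} (h : m.1.1 i ≠ 0) :
    lamRow A m.1.2 i = 0 :=
  (((OKA_iff A m.1).1 m.2).2 i).resolve_left h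

/-- The eigenvalue of `p^{Q_A + Q^∨_A}`. -/
noncomputable abbrev frobWeight (K : Type) [Field K] {n : ℕ} (p : ℕ)
    (A : Matrix (Fin n) (Fin n) ℕ) (q : BIdx A) : K :=
  (p : K) ^ (qexpQ A q + qexpDual A q)

lemma frobWeight_mul_dxF (p : ℕ) (π : K) {S : Finset (Fin n)} {i : Fin n} (hi : i ∈ S)
    (c : RFull K A) (m : AMon A) :
    frobWeight K p A (m, S) * dxF K π A i c m
      = p * dxF K π A i (fun m => frobWeight K p A (m, S.erase i) * c m) m := by
  rw [dxF_apply, dxF_apply, mul_add, mul_add]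
  congr 1
  · by_cases h : m.1.1 i = 0
    · simp [h]
    · rw [frobWeight, qexp_erase hi (lamRow_eq_zero_of_ne_zero h) (m' := m) rfl]
      ring
  · simp only [Finset.mul_sum]
    refine Finset.sum_congr rfl fun j _ => ?_
    split_ifs with h
    · by_cases hji : A j i = 0
      · simp [hji]
      · have h1 : m.1.1 i ≠ 0 := by have := h.1 i; omega
        rw [frobWeight, qexp_erase hi (lamRow_eq_zero_of_ne_zero h1)
          (m' := ⟨((fun k => m.1.1 k - A j k), m.1.2), h.2⟩) rfl]
        ring
    · simp

lemma frobWeight_mul_dyF [CharZero K] (hA : (Aq A).det ≠ 0) (p : ℕ) (π : K) {S : Finset (Fin n)}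
    {i : Fin n} (hi : i ∉ S) (c : RFull K A) (m : AMon A) :
    frobWeight K p A (m, S) * dyF K π A i c m
      = p * dyF K π A i (fun m => frobWeight K p A (m, insert i S) * c m) m := by
  rw [dyF_apply, dyF_apply, mul_add, mul_add]
  congr 1
  · by_cases h : lamRow A m.1.2 i = 0
    · simp [h]
    · rw [frobWeight, qexp_insert hi h (m' := m) fun _ _ => rfl]
      ring
  · split_ifs with h
    · have h1 : m.1.2 = (fun j => m.1.2 j - A j i) + Aᵀ i := by
        funext j
        exact (Nat.sub_add_cancel (h.1 j)).symm
      have h2 : ∀ j, lamRow A m.1.2 j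
          = lamRow A (fun j => m.1.2 j - A j i) j + if i = j then 1 else 0 := by
        intro j
        rw [← gamRow_row (det_Aq_transpose_ne_zero hA) i j]
        conv_lhs => rw [h1]
        exact congr_fun (gamRow_add Aᵀ _ _) j
      have h3 : lamRow A m.1.2 i ≠ 0 := by
        have := ((OKA_iff A _).1 h.2).1 i
        rw [h2, if_pos rfl]
        dsimp only at this
        linarith
      rw [frobWeight, qexp_insert hi h3 (m' := ⟨(m.1.1, fun j => m.1.2 j - A j i), h.2⟩)
        fun j hj => by rw [h2 j, if_neg hj.symm, add_zero]]
      ring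
    · simp

lemma FrFull_apply (p : ℕ) (π : K) (c : BFull K A) (m : AMon A) (S : Finset (Fin n)) :
    FrFull K p π A c (m, S)
      = thetaF K A p π (fun m => frobWeight K p A (m, S) * c (m, S)) m := by
  rw [FrFull, LinearMap.comp_apply, tmap_apply, LinearMap.id_apply]
  rfl

lemma dFull_apply (π : K) (c : BFull K A) (m : AMon A) (S : Finset (Fin n)) :
    dFull K π A c (m, S)
      = (∑ i, if i ∈ S then
          (-1 : K) ^ (S.filter (· < i)).card * dxF K π A i (fun m => c (m, S.erase i)) m else 0)
        + ∑ i, if i ∈ S then 0 else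
          (-1 : K) ^ (S.filter (· < i)).card * dyF K π A i (fun m => c (m, insert i S)) m := by
  simp only [dFull, LinearMap.add_apply, LinearMap.sum_apply, Pi.add_apply, Finset.sum_apply,
    tmap_apply, mulE_apply, contrE_apply]

theorem FrFull_comp_dFull [CharZero K] (hA : (Aq A).det ≠ 0) {p : ℕ} (hp : p ≠ 0) {π : K}
    (hπ : π ≠ 0) :
    (FrFull K p π A).comp (dFull K π A) = (dFull K π A).comp (FrFull K p π A) := by
  refine LinearMap.ext fun c => funext fun ⟨m, S⟩ => ?_
  rw [LinearMap.comp_apply, LinearMap.comp_apply, FrFull_apply, dFull_apply]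
  have h1 : (fun m => frobWeight K p A (m, S) * dFull K π A c (m, S))
      = (∑ i, if i ∈ S then (-1 : K) ^ (S.filter (· < i)).card • ((p : K) •
            dxF K π A i (fun m => frobWeight K p A (m, S.erase i) * c (m, S.erase i))) else 0)
        + ∑ i, if i ∈ S then 0 else (-1 : K) ^ (S.filter (· < i)).card • ((p : K) •
            dyF K π A i (fun m => frobWeight K p A (m, insert i S) * c (m, insert i S))) := by
    funext m
    rw [dFull_apply, mul_add, Finset.mul_sum, Finset.mul_sum, Pi.add_apply, Finset.sum_apply,
      Finset.sum_apply]
    congr 1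
    · refine Finset.sum_congr rfl fun i _ => ?_
      split_ifs with hi
      · rw [mul_left_comm, frobWeight_mul_dxF p π hi]; rfl
      · simp
    · refine Finset.sum_congr rfl fun i _ => ?_
      split_ifs with hi
      · simp
      · rw [mul_left_comm, frobWeight_mul_dyF hA p π hi]; rfl
  rw [h1, map_add, map_sum, map_sum, Pi.add_apply, Finset.sum_apply, Finset.sum_apply]
  congr 1
  · refine Finset.sum_congr rfl fun i _ => ?_
    split_ifs with hi
    · rw [map_smul, map_smul, ← dxF_thetaF hA hp]
      simp only [FrFull_apply]
      rfl
    · simp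
  · refine Finset.sum_congr rfl fun i _ => ?_
    split_ifs with hi
    · simp
    · rw [map_smul, map_smul, ← dyF_thetaF hA hp hπ]
      simp only [FrFull_apply]
      rfl

end ChainMap

/-! ### Frobenius and duality -/

section Duality

variable {n : ℕ} {A : Matrix (Fin n) (Fin n) ℕ} {K : Type} [Field K]

lemma DAmapF_apply (c : RFull K A) (m : AMon Aᵀ) :
    DAmapF K A c m = if h : OKA A (m.1.2, m.1.1) then c ⟨(m.1.2, m.1.1), h⟩ else 0 :=
  getD_map_dite (K := K) (α := AMon A) (P := OKA A (m.1.2, m.1.1))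
    (fun h => ⟨(m.1.2, m.1.1), h⟩) c

/-- Exchange the exponents `γ` and `λ`. -/
noncomputable def swapMon (m : Fin n ⊕ Fin n →₀ ℕ) : Fin n ⊕ Fin n →₀ ℕ := ofMon (toMon m).swap

lemma swapMon_add (a b : Fin n ⊕ Fin n →₀ ℕ) : swapMon (a + b) = swapMon a + swapMon b := by
  ext (i | i) <;> rfl

@[simp] lemma swapMon_swapMon (m : Fin n ⊕ Fin n →₀ ℕ) : swapMon (swapMon m) = m := by
  ext (i | i) <;> rfl

lemma swapMon_smul (q : ℕ) (m : Fin n ⊕ Fin n →₀ ℕ) : swapMon (q • m) = q • swapMon m := by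
  ext (i | i) <;> rfl

/-- Exchange the variables `x` and `y`. -/
noncomputable def swapSeries (f : XYSeries K n) : XYSeries K n :=
  mkSeries fun m => MvPowerSeries.coeff (swapMon m) f

lemma coeff_swapSeries (f : XYSeries K n) (m : Fin n ⊕ Fin n →₀ ℕ) :
    MvPowerSeries.coeff m (swapSeries f) = MvPowerSeries.coeff (swapMon m) f := rfl

lemma swapSeries_mul (f g : XYSeries K n) :
    swapSeries (f * g) = swapSeries f * swapSeries g := by
  ext m
  rw [coeff_swapSeries, MvPowerSeries.coeff_mul, MvPowerSeries.coeff_mul]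
  refine Finset.sum_bij' (fun ab _ => (swapMon ab.1, swapMon ab.2))
    (fun ab _ => (swapMon ab.1, swapMon ab.2)) ?_ ?_ ?_ ?_ ?_
  · intro ab hab
    rw [Finset.HasAntidiagonal.mem_antidiagonal] at hab ⊢
    rw [← swapMon_add, hab, swapMon_swapMon]
  · intro ab hab
    rw [Finset.HasAntidiagonal.mem_antidiagonal] at hab ⊢
    rw [← swapMon_add, hab]
  · intro ab _
    simp
  · intro ab _
    simp
  · intro ab _
    rw [coeff_swapSeries, coeff_swapSeries, swapMon_swapMon, swapMon_swapMon]

lemma swapSeries_expand {p : ℕ} (hp : p ≠ 0) (f : XYSeries K n) :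
    swapSeries (MvPowerSeries.expand p hp f) = MvPowerSeries.expand p hp (swapSeries f) := by
  ext m
  rw [coeff_swapSeries]
  by_cases h : ∀ i, p ∣ m i
  · obtain ⟨l, rfl⟩ := eq_smul_of_forall_dvd h
    rw [swapMon_smul, MvPowerSeries.coeff_expand_smul, MvPowerSeries.coeff_expand_smul,
      coeff_swapSeries]
  · rw [coeff_expand_eq_zero hp h, coeff_expand_eq_zero hp]
    exact fun h' => h (Sum.forall.2 ⟨fun i => h' (Sum.inr i), fun i => h' (Sum.inl i)⟩)

lemma swapSeries_zSeries (p : ℕ) (π : K) :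
    swapSeries (zSeries p π A) = zSeries p π Aᵀ := by
  ext m
  rw [coeff_swapSeries, coeff_zSeries, coeff_zSeries, mul_comm]
  rfl

lemma toSeries_DAmapF (c : RFull K A) :
    toSeries Aᵀ (DAmapF K A c) = projOK Aᵀ (swapSeries (toSeries A c)) := by
  refine toSeries_eq_projOK fun m => ?_
  rw [coeff_swapSeries, DAmapF_apply]
  exact (coeff_toSeries_ofMon c (m.1.2, m.1.1)).symm

lemma OKA_transpose_toMon_iff (m : Fin n ⊕ Fin n →₀ ℕ) :
    OKA Aᵀ (toMon m) ↔ (∀ i, 0 ≤ gamRow A (toMon (swapMon m)).1 i) ∧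
      gamRow A (toMon (swapMon m)).1 ⬝ᵥ (fun i => ((toMon (swapMon m)).2 i : ℚ)) = 0 :=
  OKA_transpose_swap_iff A (toMon m).swap

lemma toSeries_DAmapF_of_gamRow_nonneg {c : RFull K A}
    (hc : ∀ m : AMon A, c m ≠ 0 → ∀ i, 0 ≤ gamRow A m.1.1 i) :
    toSeries Aᵀ (DAmapF K A c) = swapSeries (toSeries A c) := by
  rw [toSeries_DAmapF]
  ext m
  rw [coeff_projOK]
  split_ifs with hm
  · rfl
  · rw [coeff_swapSeries, toSeries, coeff_mkSeries]
    split_ifs with hs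
    · by_contra h
      exact hm ((OKA_transpose_toMon_iff m).2 ⟨hc ⟨_, hs⟩ (Ne.symm h), hs.2⟩)
    · rfl

lemma DAmapF_thetaF (hA : (Aq A).det ≠ 0) {p : ℕ} (hp : p ≠ 0) (π : K) {c : RFull K A}
    (hc : ∀ m : AMon A, c m ≠ 0 → ∀ i, 0 ≤ gamRow A m.1.1 i) :
    DAmapF K A (thetaF K A p π c) = thetaF K Aᵀ p π (DAmapF K A c) := by
  apply toSeries_injective
  rw [toSeries_DAmapF, toSeries_thetaF hp, toSeries_thetaF hp, frobSeries, frobSeries,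
    toSeries_DAmapF_of_gamRow_nonneg hc, ← swapSeries_expand, ← swapSeries_zSeries,
    ← swapSeries_mul]
  ext m
  simp only [coeff_projOK, coeff_swapSeries]
  split_ifs with h1 h2
  · rfl
  · by_contra h
    refine h2 ⟨?_, ((OKA_transpose_toMon_iff m).1 h1).2⟩
    exact ((lamNonneg_zSeries hA p π).mul ((lamNonneg_toSeries c).expand hp)) _ (Ne.symm h)
  · rfl

lemma pQhatInvDiag_apply (p : ℕ) (π : K) (c : BFull K A) (m : AMon A) :
    (fun S => pQhatInvDiag K p π A c (m, S)) = (List.finRange n).foldr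
      (fun i v => v + (if gamRow A m.1.1 i = 0 then 0 else (p : K) ^ (-2 : ℤ) - 1) •
        EA K π A i (EAdual K π A i v)) (fun S => c (m, S)) := by
  rw [pQhatInvDiag]
  induction List.finRange n with
  | nil => rfl
  | cons i l ih =>
    rw [List.foldr_cons, ← ih]
    funext S
    simp only [List.map_cons, List.foldr_cons, LinearMap.comp_apply, LinearMap.add_apply,
      LinearMap.id_apply, LinearMap.smul_apply, Pi.add_apply, Pi.smul_apply, QhatFull, tmap_apply]
    congr 1
    set v : ExtV K (Fin n) := fun S => (List.foldr (fun f g => f.comp g) LinearMap.id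
      (l.map fun i => LinearMap.id + ((p : K) ^ (-2 : ℤ) - 1) • QhatFull K π A i)) c (m, S) with hv
    change ((p : K) ^ (-2 : ℤ) - 1) * EA K π A i (EAdual K π A i
      ((if gamRow A m.1.1 i = 0 then (0 : K) else 1) • v)) S = _
    split_ifs
    · simp
    · rw [one_smul]
      rfl

lemma prod_one_add_inv_sq {p : K} (hp : p ≠ 0) (P : Fin n → Prop) [DecidablePred P] (T : Finset (Fin n)) :
    ((List.finRange n).map fun i => if i ∈ T then 1 else
        1 + (if P i then 0 else p ^ (-2 : ℤ) - 1)).prod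
      * p ^ (2 * (Finset.univ.filter fun i => i ∉ T ∧ ¬ P i).card) = 1 := by
  rw [← List.ofFn_eq_map, List.prod_ofFn, pow_mul, ← Finset.prod_const, Finset.prod_filter,
    ← Finset.prod_mul_distrib]
  refine Finset.prod_eq_one fun i _ => ?_
  by_cases h1 : i ∈ T <;> by_cases h2 : P i <;> simp [h1, h2]
  field_simp

lemma starA_card (π : K) (p : K) (f : ℤ → ℤ) (v : ExtV K (Fin n)) (T : Finset (Fin n)) :
    starA K π A (fun S => p ^ f S.card * v S) T = p ^ f (n - T.card) * starA K π A v T := by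
  rw [starA_apply_eq_sum, starA_apply_eq_sum π A v, Finset.mul_sum]
  refine Finset.sum_congr rfl fun S _ => ?_
  by_cases h : starA K π A (Pi.single S 1) T = 0
  · rw [h]; ring
  · have := extHomogeneous_starA_single π A S T h
    rw [Fintype.card_fin] at this
    rw [show (S.card : ℤ) = n - T.card by omega]
    ring

lemma starA_frobenius [CharZero K] (hA : (A.map ((↑) : ℕ → K)).det ≠ 0) {π : K} (hπ : π ≠ 0)
    {p : K} (hp : p ≠ 0) (P : Fin n → Prop) [DecidablePred P] (v : ExtV K (Fin n)) (T : Finset (Fin n)) :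
    starA K π A (fun S => p ^ S.card * v S) T
      = p ^ (T.card + 2 * (Finset.univ.filter fun i => i ∉ T ∧ ¬ P i).card)
        * starA K π A (fun S => p ^ (2 * (S.card : ℤ) - n) * ((List.finRange n).foldr
          (fun i v => v + (if P i then 0 else p ^ (-2 : ℤ) - 1) • EA K π A i (EAdual K π A i v))
            v) S) T := by
  have h1 := starA_card (A := A) π p (fun k => k) v T
  simp only [zpow_natCast] at h1
  rw [h1, starA_card (A := A) π p (fun k => 2 * k - n), starA_foldr hπ hA
    (fun i => if P i then 0 else p ^ (-2 : ℤ) - 1), pow_add]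
  have h2 := prod_one_add_inv_sq hp P T
  have h3 : p ^ ((n : ℤ) - T.card) = p ^ T.card * p ^ (2 * ((n : ℤ) - T.card) - n) := by
    rw [← zpow_natCast, ← zpow_add₀ hp]
    congr 1
    ring
  rw [h3]
  linear_combination (-(p ^ T.card * p ^ (2 * ((n : ℤ) - T.card) - n) * starA K π A v T)) * h2

theorem DeltaF_FrFull [CharZero K] (hA : (Aq A).det ≠ 0) (hAK : (A.map ((↑) : ℕ → K)).det ≠ 0)
    {p : ℕ} (hp : p ≠ 0) (hpK : (p : K) ≠ 0) {π : K} (hπ : π ≠ 0) {c : BFull K A}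
    (hc : ∀ q, c q ≠ 0 → gamOK A q) :
    DeltaF K π A (FrFull K p π A c)
      = FrFull K p π Aᵀ (DeltaF K π A
          (pExtDiag K p A (pQhatInvDiag K p π A (pQdual2diag K p A c)))) := by
  funext ⟨μ, T⟩
  set c' := pExtDiag K p A (pQhatInvDiag K p π A (pQdual2diag K p A c)) with hc'
  rw [FrFull_apply, DeltaF, tmap_apply, starA_apply_eq_sum]
  have h1 : ∀ S, DAmapF K A (fun m => FrFull K p π A c (m, S))
      = thetaF K Aᵀ p π (DAmapF K A fun m => frobWeight K p A (m, S) * c (m, S)) := by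
    intro S
    rw [← DAmapF_thetaF hA hp π fun m hm => hc (m, S) (right_ne_zero_of_mul hm)]
    congr 1
    funext m
    exact FrFull_apply p π c m S
  have h2 : (fun m => frobWeight K p Aᵀ (m, T) * tmap (DAmapF K A) (starA K π A) c' (m, T))
      = ∑ S, starA K π A (Pi.single S 1) T •
        DAmapF K A fun m => frobWeight K p A (m, S) * c (m, S) := by
    funext m
    rw [tmap_apply, Finset.sum_apply]
    simp only [Pi.smul_apply, smul_eq_mul]
    rw [← starA_apply_eq_sum π A (fun S => DAmapF K A (fun m => frobWeight K p A (m, S) * c (m, S)) m)]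
    simp only [DAmapF_apply]
    split_ifs with hm
    · set ν : AMon A := ⟨(m.1.2, m.1.1), hm⟩ with hν
      have h3 := starA_frobenius hAK hπ hpK (fun i => gamRow A m.1.2 i = 0)
        (fun S => (p : K) ^ (2 * qexpDual A (ν, S)) * c (ν, S)) T
      have h4 := pQhatInvDiag_apply p π (pQdual2diag K p A c) ν
      have h5 : ∀ S, frobWeight K p A (ν, S) * c (ν, S)
          = (p : K) ^ S.card * ((p : K) ^ (2 * qexpDual A (ν, S)) * c (ν, S)) := by
        intro S
        rw [frobWeight, qexpQ]
        ring
      have h6 : ∀ S, c' (ν, S) = (p : K) ^ (2 * (S.card : ℤ) - n)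
          * pQhatInvDiag K p π A (pQdual2diag K p A c) (ν, S) := fun S => rfl
      simp only [h5, h6, h3]
      have h7 := fun S => congr_fun h4 S
      beta_reduce at h7
      simp only [h7]
      have h8 : qexpQ Aᵀ (m, T) + qexpDual Aᵀ (m, T)
          = T.card + 2 * (Finset.univ.filter fun i => i ∉ T ∧ ¬ gamRow A m.1.2 i = 0).card := by
        rw [qexpQ, add_assoc, ← two_mul, qexpDual]
        simp only [lamRow_eq_gamRow_transpose, Matrix.transpose_transpose]
      rw [frobWeight, h8]
      rfl
    · change _ * starA K π A 0 T = starA K π A 0 T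
      simp
  rw [h2, map_sum, Finset.sum_apply]
  refine Finset.sum_congr rfl fun S _ => ?_
  rw [h1, map_smul]
  rfl

end Duality

/-! ### Overconvergence of the Frobenius -/

section Overconvergence

/-- Geometric decay of a family with respect to the degree `d`. -/
def GeomDecay {K α : Type} [Norm K] (d : α → ℕ) (c : α → K) : Prop :=
  ∃ C r : ℝ, 0 ≤ C ∧ 0 < r ∧ r < 1 ∧ ∀ a, ‖c a‖ ≤ C * r ^ d a

variable {K : Type} [NontriviallyNormedField K]

lemma GeomDecay.mono {α : Type} {d : α → ℕ} {c c' : α → K} (hc : GeomDecay d c)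
    (h : ∀ a, ‖c' a‖ ≤ ‖c a‖) : GeomDecay d c' := by
  obtain ⟨C, r, hC, hr, hr1, hb⟩ := hc
  exact ⟨C, r, hC, hr, hr1, fun a => (h a).trans (hb a)⟩

lemma GeomDecay.exists_common {ι α : Type} [Finite ι] [Nonempty ι] {d : α → ℕ} {c : ι → α → K}
    (hc : ∀ i, GeomDecay d (c i)) :
    ∃ C r : ℝ, 0 ≤ C ∧ 0 < r ∧ r < 1 ∧ ∀ i a, ‖c i a‖ ≤ C * r ^ d a := by
  choose C r hC hr hr1 hb using hc
  obtain ⟨i, hi⟩ := Finite.exists_max C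
  obtain ⟨j, hj⟩ := Finite.exists_max r
  refine ⟨C i, r j, hC i, hr j, hr1 j, fun k a => (hb k a).trans ?_⟩
  exact mul_le_mul (hi k) (pow_le_pow_left₀ (hr k).le (hj k) _) (by have := hr k; positivity) (hC i)

lemma geomDecay_iff_overconvergent {α : Type} {p : ℕ} (hp : 1 < p) {d : α → ℕ}
    (hd : ∀ N, {a | d a < N}.Finite) (c : α → K) :
    (∃ M : ℝ, 0 < M ∧ {a | ¬ ‖c a‖ ≤ (p : ℝ) ^ (-(M * (d a : ℝ)))}.Finite) ↔ GeomDecay d c := by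
  have hp1 : (1 : ℝ) < p := by exact_mod_cast hp
  have hp0 : (0 : ℝ) < p := by linarith
  have hpow : ∀ (M : ℝ) (k : ℕ), (p : ℝ) ^ (-(M * (k : ℝ))) = ((p : ℝ) ^ (-M)) ^ k := by
    intro M k
    rw [← Real.rpow_mul_natCast hp0.le, neg_mul]
  simp only [hpow]
  constructor
  · rintro ⟨M, hM, hfin⟩
    set r := (p : ℝ) ^ (-M) with hr
    have hr0 : 0 < r := Real.rpow_pos_of_pos hp0 _
    have hr1 : r < 1 := Real.rpow_lt_one_of_one_lt_of_neg hp1 (neg_lt_zero.2 hM)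
    have hnn : ∀ a ∈ hfin.toFinset, 0 ≤ ‖c a‖ / r ^ d a := fun a _ => by positivity
    refine ⟨1 + ∑ a ∈ hfin.toFinset, ‖c a‖ / r ^ d a, r,
      add_nonneg zero_le_one (Finset.sum_nonneg hnn), hr0, hr1, fun a => ?_⟩
    by_cases ha : a ∈ hfin.toFinset
    · rw [← div_le_iff₀ (by positivity)]
      exact (Finset.single_le_sum hnn ha).trans (le_add_of_nonneg_left zero_le_one)
    · have ha' : ‖c a‖ ≤ r ^ d a := by simpa using ha
      refine ha'.trans (le_mul_of_one_le_left (by positivity) ?_)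
      exact le_add_of_nonneg_right (Finset.sum_nonneg hnn)
  · rintro ⟨C, r, hC, hr0, hr1, hb⟩
    set s := Real.sqrt r with hs
    have hs0 : 0 < s := Real.sqrt_pos.2 hr0
    have hs1 : s < 1 := by rw [hs, Real.sqrt_lt' one_pos]; simpa using hr1
    have hss : r = s * s := (Real.mul_self_sqrt hr0.le).symm
    refine ⟨-Real.logb p s, neg_pos.2 (Real.logb_neg hp1 hs0 hs1), ?_⟩
    rw [neg_neg, Real.rpow_logb hp0 hp1.ne' hs0]
    have ht : Filter.Tendsto (fun k : ℕ => C * s ^ k) Filter.atTop (nhds 0) := by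
      simpa using (tendsto_pow_atTop_nhds_zero_of_lt_one hs0.le hs1).const_mul C
    obtain ⟨N, hN⟩ := Filter.eventually_atTop.1 (ht.eventually (ge_mem_nhds zero_lt_one))
    refine (hd N).subset fun a ha => ?_
    by_contra hlt
    refine ha ((hb a).trans ?_)
    rw [hss, mul_pow, ← mul_assoc]
    exact mul_le_of_le_one_left (by positivity) (hN _ (not_lt.1 hlt))

lemma norm_sum_le_of_nonarch (hna : ∀ a b : K, ‖a + b‖ ≤ max ‖a‖ ‖b‖) {ι : Type}
    (s : Finset ι) (f : ι → K) {B : ℝ} (hB : 0 ≤ B) (h : ∀ i ∈ s, ‖f i‖ ≤ B) :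
    ‖∑ i ∈ s, f i‖ ≤ B := by
  induction s using Finset.induction_on with
  | empty => simpa
  | insert a s ha ih =>
    rw [Finset.sum_insert ha]
    exact (hna _ _).trans (max_le (h a (Finset.mem_insert_self a s))
      (ih fun i hi => h i (Finset.mem_insert_of_mem hi)))

variable {n : ℕ} {A : Matrix (Fin n) (Fin n) ℕ}

lemma finite_setOf_degMon_lt (N : ℕ) : {q : BIdx A | degMon q.1.1 < N}.Finite := by
  have h : {m : MonIdx (Fin n) | degMon m < N}.Finite := by
    refine (Set.finite_Iic ((fun _ => N, fun _ => N) : MonIdx (Fin n))).subset fun m hm => ?_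
    have hm : degMon m < N := hm
    rw [degMon] at hm
    refine ⟨fun i => ?_, fun i => ?_⟩
    · have := Finset.single_le_sum (f := m.1) (fun _ _ => Nat.zero_le _) (Finset.mem_univ i)
      dsimp only
      omega
    · have := Finset.single_le_sum (f := m.2) (fun _ _ => Nat.zero_le _) (Finset.mem_univ i)
      dsimp only
      omega
  have h2 : {m : AMon A | degMon m.1 < N}.Finite := h.preimage Subtype.val_injective.injOn
  exact (h2.prod (Set.finite_univ (α := Finset (Fin n)))).subset fun q hq => ⟨hq, trivial⟩

lemma overcB_iff {p : ℕ} (hp : 1 < p) (c : BFull K A) :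
    OvercB p c ↔ GeomDecay (fun q : BIdx A => degMon q.1.1) c :=
  geomDecay_iff_overconvergent hp finite_setOf_degMon_lt c

/-- Geometric decay of the coefficients of a power series. -/
def SeriesDecay (f : XYSeries K n) : Prop :=
  GeomDecay (fun m => degMon (toMon m)) fun m => MvPowerSeries.coeff m f

lemma degMon_toMon_add (a b : Fin n ⊕ Fin n →₀ ℕ) :
    degMon (toMon (a + b)) = degMon (toMon a) + degMon (toMon b) := by
  simp only [degMon, toMon, Finsupp.add_apply, Finset.sum_add_distrib]
  ring

lemma degMon_toMon_smul (q : ℕ) (a : Fin n ⊕ Fin n →₀ ℕ) :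
    degMon (toMon (q • a)) = q * degMon (toMon a) := by
  simp only [degMon, toMon, Finsupp.smul_apply, smul_eq_mul, ← Finset.mul_sum]
  ring

lemma GeomDecay.series {c : BFull K A} (hc : GeomDecay (fun q : BIdx A => degMon q.1.1) c)
    (S : Finset (Fin n)) : SeriesDecay (toSeries A fun m => c (m, S)) := by
  obtain ⟨C, r, hC, hr, hr1, hb⟩ := hc
  refine ⟨C, r, hC, hr, hr1, fun m => ?_⟩
  dsimp only
  rw [toSeries, coeff_mkSeries]
  split_ifs with h
  · exact hb (⟨_, h⟩, S)
  · rw [norm_zero]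
    positivity

lemma geomDecay_of_series {c : BFull K A} (hc : ∀ S, SeriesDecay (toSeries A fun m => c (m, S))) :
    GeomDecay (fun q : BIdx A => degMon q.1.1) c := by
  obtain ⟨C, r, hC, hr, hr1, hb⟩ := GeomDecay.exists_common hc
  refine ⟨C, r, hC, hr, hr1, fun q => ?_⟩
  have := hb q.2 (ofMon q.1.1)
  rwa [coeff_toSeries_coe] at this

lemma SeriesDecay.projOK {f : XYSeries K n} (hf : SeriesDecay f) : SeriesDecay (projOK A f) := by
  refine GeomDecay.mono hf fun m => ?_
  rw [coeff_projOK]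
  split_ifs <;> simp

lemma SeriesDecay.mul (hna : ∀ a b : K, ‖a + b‖ ≤ max ‖a‖ ‖b‖) {f g : XYSeries K n}
    (hf : SeriesDecay f) (hg : SeriesDecay g) : SeriesDecay (f * g) := by
  obtain ⟨C, r, hC, hr, hr1, hb⟩ := hf
  obtain ⟨C', r', hC', hr', hr1', hb'⟩ := hg
  have hm : 0 < max r r' := lt_max_of_lt_left hr
  refine ⟨C * C', max r r', mul_nonneg hC hC', hm, max_lt hr1 hr1', fun m => ?_⟩
  dsimp only
  rw [MvPowerSeries.coeff_mul]
  refine norm_sum_le_of_nonarch hna _ _ (by positivity) fun ab hab => ?_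
  rw [← Finset.HasAntidiagonal.mem_antidiagonal.1 hab, degMon_toMon_add, pow_add, norm_mul,
    mul_mul_mul_comm]
  refine mul_le_mul ((hb ab.1).trans ?_) ((hb' ab.2).trans ?_) (norm_nonneg _) (by positivity)
  · exact mul_le_mul_of_nonneg_left (pow_le_pow_left₀ hr.le (le_max_left _ _) _) hC
  · exact mul_le_mul_of_nonneg_left (pow_le_pow_left₀ hr'.le (le_max_right _ _) _) hC'

lemma exists_pow_eq {r : ℝ} (hr : 0 < r) (hr1 : r < 1) {q : ℕ} (hq : q ≠ 0) :
    ∃ s : ℝ, 0 < s ∧ s < 1 ∧ s ^ q = r :=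
  ⟨r ^ (q⁻¹ : ℝ), Real.rpow_pos_of_pos hr _, Real.rpow_lt_one hr.le hr1 (by positivity),
    Real.rpow_inv_natCast_pow hr.le hq⟩

lemma SeriesDecay.expand {p : ℕ} (hp : p ≠ 0) {f : XYSeries K n} (hf : SeriesDecay f) :
    SeriesDecay (MvPowerSeries.expand p hp f) := by
  obtain ⟨C, r, hC, hr, hr1, hb⟩ := hf
  obtain ⟨s, hs, hs1, rfl⟩ := exists_pow_eq hr hr1 hp
  refine ⟨C, s, hC, hs, hs1, fun m => ?_⟩
  dsimp only
  by_cases h : ∀ i, p ∣ m i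
  · obtain ⟨l, rfl⟩ := eq_smul_of_forall_dvd h
    rw [MvPowerSeries.coeff_expand_smul, degMon_toMon_smul, pow_mul]
    exact hb l
  · rw [coeff_expand_eq_zero hp h, norm_zero]
    positivity

lemma exists_norm_Zcoef_le [CharZero K] (hA : (Aq A).det ≠ 0) {p : ℕ} [Fact p.Prime]
    (hna : ∀ a b : K, ‖a + b‖ ≤ max ‖a‖ ‖b‖)
    (hpnorm : ‖(p : K)‖ = (p : ℝ)⁻¹) {π : K} (hπ : π ^ (p - 1) = -(p : K)) :
    GeomDecay (fun δ : Fin n → ℕ => ∑ i, δ i) (Zcoef K p π A) := by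
  obtain ⟨C, r, hC, hr, hr1, hb⟩ := exists_norm_dworkCoef_le hna hpnorm hπ
  set L := (∑ i, ∑ j, A i j) + 1 with hL
  obtain ⟨s, hs, hs1, rfl⟩ := exists_pow_eq hr hr1 (Nat.succ_ne_zero (∑ i, ∑ j, A i j))
  have hC0 : 0 ≤ C := zero_le_one.trans hC
  refine ⟨C ^ n, s, pow_nonneg hC0 n, hs, hs1, fun δ => ?_⟩
  by_cases h : Zcoef K p π A δ = 0
  · rw [h, norm_zero]
    positivity
  obtain ⟨k, rfl⟩ := exists_vecMul_of_Zcoef_ne_zero h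
  rw [Zcoef_vecMul hA, norm_prod]
  have hdeg : ∑ j, Matrix.vecMul k A j ≤ L * ∑ i, k i := by
    simp only [Matrix.vecMul, dotProduct]
    rw [Finset.sum_comm, Finset.mul_sum]
    refine Finset.sum_le_sum fun i _ => ?_
    rw [← Finset.mul_sum, mul_comm]
    refine Nat.mul_le_mul_right _ (Nat.le_succ_of_le ?_)
    exact Finset.single_le_sum (f := fun i => ∑ j, A i j) (fun _ _ => Nat.zero_le _)
      (Finset.mem_univ i)
  calc ∏ i, ‖dworkCoef K p π (k i)‖ ≤ ∏ i, C * (s ^ L) ^ k i :=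
        Finset.prod_le_prod (fun _ _ => norm_nonneg _) fun i _ => hb (k i)
    _ = C ^ n * s ^ (L * ∑ i, k i) := by
        rw [Finset.prod_mul_distrib, Finset.prod_const, Finset.card_univ, Fintype.card_fin,
          Finset.prod_pow_eq_pow_sum, pow_mul]
    _ ≤ C ^ n * s ^ (∑ j, Matrix.vecMul k A j) :=
        mul_le_mul_of_nonneg_left (pow_le_pow_of_le_one hs.le hs1.le hdeg) (pow_nonneg hC0 n)

lemma seriesDecay_zSeries [CharZero K] (hA : (Aq A).det ≠ 0) {p : ℕ} [Fact p.Prime]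
    (hna : ∀ a b : K, ‖a + b‖ ≤ max ‖a‖ ‖b‖)
    (hpnorm : ‖(p : K)‖ = (p : ℝ)⁻¹) {π : K} (hπ : π ^ (p - 1) = -(p : K)) :
    SeriesDecay (zSeries p π A) := by
  obtain ⟨C, r, hC, hr, hr1, hb⟩ := exists_norm_Zcoef_le hA hna hpnorm hπ
  obtain ⟨C', r', hC', hr', hr1', hb'⟩ :=
    exists_norm_Zcoef_le (det_Aq_transpose_ne_zero hA) hna hpnorm hπ
  have hm : 0 < max r r' := lt_max_of_lt_left hr
  refine ⟨C * C', max r r', mul_nonneg hC hC', hm, max_lt hr1 hr1', fun m => ?_⟩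
  dsimp only
  rw [coeff_zSeries, degMon, pow_add, norm_mul, mul_mul_mul_comm]
  refine mul_le_mul ((hb _).trans ?_) ((hb' _).trans ?_) (norm_nonneg _) (by positivity)
  · exact mul_le_mul_of_nonneg_left (pow_le_pow_left₀ hr.le (le_max_left _ _) _) hC
  · exact mul_le_mul_of_nonneg_left (pow_le_pow_left₀ hr'.le (le_max_right _ _) _) hC'

theorem overcB_FrFull [CharZero K] (hA : (Aq A).det ≠ 0) {p : ℕ} [hp : Fact p.Prime]
    (hna : ∀ a b : K, ‖a + b‖ ≤ max ‖a‖ ‖b‖)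
    (hpnorm : ‖(p : K)‖ = (p : ℝ)⁻¹) {π : K} (hπ : π ^ (p - 1) = -(p : K)) {c : BFull K A}
    (hc : OvercB p c) : OvercB p (FrFull K p π A c) := by
  have hp0 : p ≠ 0 := hp.out.ne_zero
  rw [overcB_iff hp.out.one_lt] at hc ⊢
  have hw : GeomDecay (fun q : BIdx A => degMon q.1.1) fun q => frobWeight K p A q * c q := by
    refine hc.mono fun q => ?_
    rw [norm_mul, frobWeight, norm_pow]
    exact mul_le_of_le_one_left (norm_nonneg _)
      (pow_le_one₀ (norm_nonneg _) (norm_natCast_le_one_of_nonarch hna p))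
  refine geomDecay_of_series fun S => ?_
  have h : (fun m => FrFull K p π A c (m, S))
      = thetaF K A p π fun m => frobWeight K p A (m, S) * c (m, S) :=
    funext fun m => FrFull_apply p π c m S
  rw [h, toSeries_thetaF hp0, frobSeries]
  exact ((seriesDecay_zSeries hA hna hpnorm hπ).mul hna ((hw.series S).expand hp0)).projOK

end Overconvergence

/-- Proposition 9.4: the Frobenius endomorphism
`Fr_A = ((Θ''_A ∘ Θ'_A) ⊗ Id) ∘ p^{Q_A + Q^∨_A}` is a chain map `B^†_A(K) → B^†_A(K)`,
and as linear maps `S^†_A(K) ⊗ ⋀(Kⁿ) → S^†_{Aᵀ}(K) ⊗ ⋀(Kⁿ)` one has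
`Δ^A ∘ Fr_A = Fr_{Aᵀ} ∘ Δ^A ∘ p^{2·ext − n} ∘ p^{−2Q̂_A} ∘ p^{2Q^∨_A}`. -/
theorem Frobenius_vs_duality
    (p : ℕ) [hp : Fact p.Prime] (K : Type) [NontriviallyNormedField K] [CompleteSpace K]
    [CharZero K] (halg : IsAlgClosed K)
    (hna : ∀ a b : K, ‖a + b‖ ≤ max ‖a‖ ‖b‖) (hpnorm : ‖(p : K)‖ = (p : ℝ)⁻¹)
    (π : K) (hπ : π ^ (p - 1) = -(p : K))
    (n : ℕ) (A : Matrix (Fin n) (Fin n) ℕ)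
    (hdet : 0 < (A.map ((↑) : ℕ → ℤ)).det ∧ (A.map ((↑) : ℕ → ℤ)).det < (p : ℤ))
    (hABH : IsBH (AlgebraicClosure (ZMod p)) A) :
    (∀ c : BFull K A, OvercB p c → OvercB p (FrFull K p π A c)) ∧
    (FrFull K p π A).comp (dFull K π A) = (dFull K π A).comp (FrFull K p π A) ∧
    (∀ c : BFull K A, COver p c →
      DeltaF K π A (FrFull K p π A c)
        = FrFull K p π Aᵀ (DeltaF K π A
            (pExtDiag K p A (pQhatInvDiag K p π A (pQdual2diag K p A c))))) := by
  have hp0 : p ≠ 0 := hp.out.ne_zero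
  have hpK : (p : K) ≠ 0 := Nat.cast_ne_zero.2 hp0
  have hπ0 : π ≠ 0 := by
    rintro rfl
    rw [zero_pow (Nat.sub_ne_zero_of_lt hp.out.one_lt), eq_comm, neg_eq_zero] at hπ
    exact hpK hπ
  have hcast (F : Type) [Field F] [CharZero F] : (A.map ((↑) : ℕ → F)).det ≠ 0 := by
    have h : (Int.castRingHom F).mapMatrix (A.map ((↑) : ℕ → ℤ)) = A.map ((↑) : ℕ → F) := by
      ext i j
      simp
    rw [← h, ← RingHom.map_det, eq_intCast]
    exact Int.cast_ne_zero.2 hdet.1.ne'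
  have hA : (Aq A).det ≠ 0 := hcast ℚ
  exact ⟨fun c hc => overcB_FrFull hA hna hpnorm hπ hc, FrFull_comp_dFull hA hp0 hπ0,
    fun c hc => DeltaF_FrFull hA (hcast K) hp0 hpK hπ0 hc.2⟩
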